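/- Let p,q ∈ ℕ and N ∈ ℤ \ {0}. The essential spectral radius of the transfer operator L : B^{p,q}_N → B^{p,q}_N is not greater than λ^{−min(p,q)}; equivalently, the part of the spectrum of L in {z ∈ ℂ : |z| > λ^{−min(p,q)}} consists of isolated eigenvalues of finite multiplicity. -/

import Mathlib

open MeasureTheory Filter Asymptotics

noncomputable section

/-- The Heisenberg group `ℍ`: `ℝ³` with the polarised group law
`(x,y,z) * (x',y',z') = (x+x', y+y', z+z'+x·y')`. -/
abbrev Heis : Type := ℝ × ℝ × ℝ

/-- The group law of the Heisenberg group. -/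
def hmul (g g' : Heis) : Heis :=
  (g.1 + g'.1, g.2.1 + g'.2.1, g.2.2 + g'.2.2 + g.1 * g'.2.1)

/-- The Lie bracket on the Lie algebra `ℝ³` of the Heisenberg group. -/
def hbracket (v w : ℝ × ℝ × ℝ) : ℝ × ℝ × ℝ :=
  (0, 0, v.1 * w.2.1 - w.1 * v.2.1)

/-- The exponential map of the Heisenberg group. -/
def hexp (v : ℝ × ℝ × ℝ) : Heis := (v.1, v.2.1, v.2.2 + v.1 * v.2.1 / 2)

/-- The inverse of the exponential map. -/
def hlog (g : Heis) : ℝ × ℝ × ℝ := (g.1, g.2.1, g.2.2 - g.1 * g.2.1 / 2)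

/-- The basis element `X` of the Lie algebra. -/
def Xvec : ℝ × ℝ × ℝ := (1, 0, 0)

/-- The basis element `Y` of the Lie algebra. -/
def Yvec : ℝ × ℝ × ℝ := (0, 1, 0)

/-- The central element `Z` of the Lie algebra. -/
def Zvec : ℝ × ℝ × ℝ := (0, 0, 1)

/-- The lattice `Γ_K = {(x, y, z/K) : x,y,z ∈ ℤ}`. -/
def GammaK (K : ℕ) : Set Heis :=
  {g | ∃ x y z : ℤ, g = ((x : ℝ), (y : ℝ), (z : ℝ) / K)}

/-- The flow generated by the left-invariant vector field associated to `U`: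
`m ↦ m * exp (t U)`. -/
def hflow (U : ℝ × ℝ × ℝ) (t : ℝ) (m : Heis) : Heis := hmul m (hexp (t • U))

/-- The action of the left-invariant vector field associated to `U` on functions. -/
def VF (U : ℝ × ℝ × ℝ) (h : Heis → ℂ) (m : Heis) : ℂ :=
  deriv (fun t : ℝ => h (hflow U t m)) 0

/-- `C^∞(M)`: smooth `Γ_K`-invariant functions on `ℍ` (functions on `M = Γ_K\ℍ`). -/
def SmoothM (K : ℕ) (h : Heis → ℂ) : Prop :=
  ContDiff ℝ (⊤ : ℕ∞) h ∧ ∀ γ ∈ GammaK K, ∀ m : Heis, h (hmul γ m) = h m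

/-- `C^q(M)`: `C^q` `Γ_K`-invariant functions on `ℍ`. -/
def CqM (K : ℕ) (q : ℕ) (g : Heis → ℂ) : Prop :=
  ContDiff ℝ q g ∧ ∀ γ ∈ GammaK K, ∀ m : Heis, g (hmul γ m) = g m

/-- `C^∞_N = {h ∈ C^∞(M) : Z h = 2πiNK·h}`. -/
def CN (K : ℕ) (N : ℤ) (h : Heis → ℂ) : Prop :=
  SmoothM K h ∧ VF Zvec h = fun m => (2 * Real.pi * Complex.I * N * K) * h m

/-- The `C^r` norm `‖f‖_{C^r} = sup_{k ≤ r} 2^{r-k} sup |f^{(k)}|` of a function on `ℝ`. -/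
def CrNorm (r : ℕ) (η : ℝ → ℂ) : ℝ :=
  ⨆ k : Fin (r + 1), (2 : ℝ) ^ (r - (k : ℕ)) * ⨆ t : ℝ, ‖iteratedDeriv (k : ℕ) η t‖

/-- The `C^r` norm of a function on `M`. -/
def MCrNorm (r : ℕ) (g : Heis → ℂ) : ℝ :=
  ⨆ k : Fin (r + 1), (2 : ℝ) ^ (r - (k : ℕ)) * ⨆ m : Heis, ‖iteratedFDeriv ℝ (k : ℕ) g m‖

/-- Test functions: `C^∞` functions with support compactly contained in `(-δ, δ)`. -/
def TestFun (δ : ℝ) (η : ℝ → ℂ) : Prop :=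
  ContDiff ℝ (⊤ : ℕ∞) η ∧ HasCompactSupport η ∧ tsupport η ⊆ Set.Ioo (-δ) δ

/-- The linear functional `ℓ_{η,m}(h) = ∫_{-δ}^{δ} η(t)·h(φ_t^W(m)) dt`. -/
def ell (Wd : ℝ × ℝ × ℝ) (δ : ℝ) (η : ℝ → ℂ) (m : Heis) (h : Heis → ℂ) : ℂ :=
  ∫ t in (-δ)..δ, η t * h (hflow Wd t m)

/-- The seminorm `|h|_{j,q}`. -/
def semiNorm (Vd Wd : ℝ × ℝ × ℝ) (δ : ℝ) (j q : ℕ) (h : Heis → ℂ) : ℝ :=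
  sSup {x : ℝ | ∃ m : Heis, ∃ η : ℝ → ℂ, TestFun δ η ∧ CrNorm q η ≤ 1 ∧
    x = ‖ell Wd δ η m ((VF Vd)^[j] h)‖}

/-- The anisotropic norm `‖h‖_{p,q}`. -/
def pqNorm (Vd Wd : ℝ × ℝ × ℝ) (δ : ℝ) (p q : ℕ) (h : Heis → ℂ) : ℝ :=
  sSup {x : ℝ | ∃ j : ℕ, j ≤ p ∧ ∃ m : Heis, ∃ η : ℝ → ℂ, TestFun δ η ∧ CrNorm q η ≤ 1 ∧
    x = ‖ell Wd δ η m ((VF Vd)^[j] h)‖}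

/-- Integration over `M = Γ_K\ℍ` with respect to the probability measure `ν`
inherited from the Haar measure, computed on the fundamental domain
`[0,1) × [0,1) × [0,1/K)` (rescaled by `K` to have total mass one). -/
def nuInt (K : ℕ) (f : Heis → ℂ) : ℂ :=
  (K : ℂ) * (∫ m in (Set.Icc (0 : ℝ) 1 ×ˢ (Set.Icc (0 : ℝ) 1 ×ˢ Set.Icc (0 : ℝ) (1 / K))), f m)

/-- The setting of the paper: a Heisenberg nilmanifold `M = Γ_K\ℍ`, a partially
hyperbolic automorphism `Φ` with `Φ_* V = λ⁻¹ V`, `Φ_* W = λ W`, `Φ_* Z = Z` for a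
Heisenberg frame `{V, W, Z}`, and a fixed small `δ > 0`. -/
structure NilSetting where
  K : ℕ
  hK : 0 < K
  lam : ℝ
  hlam : 1 < lam
  Vd : ℝ × ℝ × ℝ
  Wd : ℝ × ℝ × ℝ
  frame : hbracket Vd Wd = Zvec
  Φ : Heis → Heis
  Φbij : Function.Bijective Φ
  Φhom : ∀ g g' : Heis, Φ (hmul g g') = hmul (Φ g) (Φ g')
  Φlattice : Φ '' GammaK K = GammaK K
  ΦV : ∀ t : ℝ, Φ (hexp (t • Vd)) = hexp ((lam⁻¹ * t) • Vd)
  ΦW : ∀ t : ℝ, Φ (hexp (t • Wd)) = hexp ((lam * t) • Wd)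
  ΦZ : ∀ t : ℝ, Φ (hexp (t • Zvec)) = hexp (t • Zvec)
  δ : ℝ
  hδ : 0 < δ

namespace NilSetting

/-- The transfer operator `L : h ↦ h ∘ Φ`. -/
def L (S : NilSetting) (h : Heis → ℂ) : Heis → ℂ := fun m => h (S.Φ m)

/-- The space `C^∞_N` as a set of functions. -/
def cn (S : NilSetting) (N : ℤ) : Set (Heis → ℂ) := {h | CN S.K N h}

/-- The anisotropic norm `‖·‖_{p,q}` of the setting. -/
def nrm (S : NilSetting) (p q : ℕ) (h : Heis → ℂ) : ℝ := pqNorm S.Vd S.Wd S.δ p q h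

/-- The seminorm `|·|_{j,q}` of the setting. -/
def snrm (S : NilSetting) (j q : ℕ) (h : Heis → ℂ) : ℝ := semiNorm S.Vd S.Wd S.δ j q h

end NilSetting

/-- `(B, j)` is a realisation of the completion of `Sset` with respect to the
norm `Nrm`: `j` is linear and isometric on `Sset` and has dense image. -/
def IsCompletion (Nrm : (Heis → ℂ) → ℝ) (Sset : Set (Heis → ℂ))
    {B : Type} [NormedAddCommGroup B] [NormedSpace ℂ B] (j : (Heis → ℂ) → B) : Prop :=
  CompleteSpace B ∧
  (∀ h ∈ Sset, ∀ h' ∈ Sset, j (h + h') = j h + j h') ∧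
  (∀ (c : ℂ), ∀ h ∈ Sset, j (c • h) = c • j h) ∧
  (∀ h ∈ Sset, ‖j h‖ = Nrm h) ∧
  Dense (j '' Sset)

/-- A quantitative quasi-compactness condition: up to finite-rank seminorms, the powers of `T`
contract at rate `μ`. -/
def QuasiCompactRate {B : Type} [NormedAddCommGroup B] [NormedSpace ℂ B]
    (T : B →L[ℂ] B) (μ : ℝ) : Prop :=
  ∃ C : ℝ, 0 ≤ C ∧ ∀ n : ℕ, ∃ (k : ℕ) (F : B →L[ℂ] (Fin k → ℂ)),
    ∀ x, ‖(T ^ (n + 1)) x‖ ≤ C * μ ^ (n + 1) * ‖x‖ + ‖F x‖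

section QuasiCompact

variable {B : Type} [NormedAddCommGroup B] [NormedSpace ℂ B] {T : B →L[ℂ] B} {μ : ℝ}

lemma QuasiCompactRate.exists_pow_le (hT : QuasiCompactRate T μ) (hμ : 0 < μ) {ρ ε : ℝ}
    (hρ : μ < ρ) (hε : 0 < ε) :
    ∃ (n k : ℕ) (F : B →L[ℂ] (Fin k → ℂ)),
      ∀ x, ‖(T ^ n) x‖ ≤ ε * ρ ^ n * ‖x‖ + ‖F x‖ := by
  obtain ⟨C, hC, h⟩ := hT
  have hρ0 : 0 < ρ := hμ.trans hρ
  have hlt : μ / ρ < 1 := (div_lt_one hρ0).2 hρ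
  have ht : Tendsto (fun n : ℕ => C * (μ / ρ) ^ n) atTop (nhds (C * 0)) :=
    (tendsto_pow_atTop_nhds_zero_of_lt_one (by positivity) hlt).const_mul C
  rw [mul_zero] at ht
  have ht' := (tendsto_add_atTop_iff_nat 1).2 ht
  obtain ⟨n, hn⟩ := (ht'.eventually (gt_mem_nhds hε)).exists
  obtain ⟨k, F, hF⟩ := h n
  refine ⟨n + 1, k, F, fun x => (hF x).trans ?_⟩
  refine add_le_add_left (mul_le_mul_of_nonneg_right ?_ (norm_nonneg x)) _
  rw [div_pow, mul_div_assoc', div_lt_iff₀ (by positivity)] at hn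
  exact hn.le

lemma exists_lt_norm_apply_sub_lt {k : ℕ} (F : B →L[ℂ] (Fin k → ℂ)) {u : ℕ → B} {R : ℝ}
    (hu : ∀ n, ‖u n‖ ≤ R) {ε : ℝ} (hε : 0 < ε) : ∃ a b, a < b ∧ ‖F (u b - u a)‖ < ε := by
  have hmem : ∀ n, F (u n) ∈ Metric.closedBall (0 : Fin k → ℂ) (‖F‖ * R) := fun n => by
    rw [mem_closedBall_zero_iff]
    exact (F.le_opNorm _).trans (by gcongr; exact hu n)
  obtain ⟨y, -, φ, hφ, hlim⟩ := (isCompact_closedBall (0 : Fin k → ℂ) _).tendsto_subseq hmem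
  obtain ⟨M, hM⟩ := Metric.cauchySeq_iff.1 hlim.cauchySeq ε hε
  refine ⟨φ M, φ (M + 1), hφ (Nat.lt_succ_self M), ?_⟩
  have := hM (M + 1) (Nat.le_succ M) M le_rfl
  rwa [dist_eq_norm, Function.comp, Function.comp, ← map_sub] at this

lemma QuasiCompactRate.not_separated (hT : QuasiCompactRate T μ) (hμ : 0 < μ) {ρ : ℝ}
    (hρ : μ < ρ) {u : ℕ → B} (hu : ∀ n, ‖u n‖ ≤ 3) :
    ¬ ∀ n a b : ℕ, a < b → ρ ^ n ≤ ‖(T ^ n) (u b - u a)‖ := by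
  intro hsep
  obtain ⟨n, k, F, hF⟩ := hT.exists_pow_le hμ hρ (ε := 1 / 12) (by norm_num)
  have hρn : 0 < ρ ^ n := pow_pos (hμ.trans hρ) n
  obtain ⟨a, b, hab, hlt⟩ := exists_lt_norm_apply_sub_lt F hu (half_pos hρn)
  have h1 := hsep n a b hab
  have h2 := hF (u b - u a)
  have h3 : ‖u b - u a‖ ≤ 6 := (norm_sub_le _ _).trans (by linarith [hu a, hu b])
  nlinarith

lemma exists_riesz_in {E F : Submodule ℂ B} (hE : IsClosed (E : Set B)) (hlt : E < F) :
    ∃ u ∈ F, ‖u‖ ≤ 3 ∧ ∀ y ∈ E, 1 ≤ ‖u - y‖ := by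
  obtain ⟨hle, x, hxF, hxE⟩ := SetLike.lt_iff_le_and_exists.1 hlt
  have hcl : IsClosed ((E.comap F.subtype : Submodule ℂ F) : Set F) :=
    hE.preimage continuous_subtype_val
  obtain ⟨u, hu, hd⟩ := riesz_lemma_of_norm_lt (c := (2 : ℂ)) (by norm_num) (R := 3)
    (by norm_num) hcl ⟨⟨x, hxF⟩, hxE⟩
  exact ⟨u, u.2, hu, fun y hy => hd ⟨y, hle hy⟩ hy⟩

lemma pow_apply_sub_mem {E F : Submodule ℂ B} {z : ℂ} (hTE : ∀ x ∈ E, T x ∈ E)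
    (hz : ∀ x ∈ F, T x - z • x ∈ E) {x : B} (hx : x ∈ F) (n : ℕ) :
    (T ^ n) x - z ^ n • x ∈ E := by
  induction n with
  | zero => simp
  | succ n ih =>
    have : (T ^ (n + 1)) x - z ^ (n + 1) • x =
        T ((T ^ n) x - z ^ n • x) + z ^ n • (T x - z • x) := by
      rw [pow_succ' T, mul_apply_eq_comp, map_sub, map_smul, smul_sub, smul_smul,
        pow_succ]
      abel
    rw [this]
    exact E.add_mem (hTE _ ih) (E.smul_mem _ (hz x hx))

lemma pow_apply_mem {E : Submodule ℂ B} (hTE : ∀ x ∈ E, T x ∈ E) {x : B} (hx : x ∈ E) (n : ℕ) :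
    (T ^ n) x ∈ E := by
  induction n with
  | zero => simpa
  | succ n ih => rw [pow_succ' T, mul_apply_eq_comp]; exact hTE _ ih

lemma pow_le_norm_smul_add {E : Submodule ℂ B} {z : ℂ} {ρ : ℝ} (hρ : 0 < ρ) (hz : ρ ≤ ‖z‖)
    {u : B} (hu : ∀ y ∈ E, 1 ≤ ‖u - y‖) (n : ℕ) {y : B} (hy : y ∈ E) :
    ρ ^ n ≤ ‖z ^ n • u + y‖ := by
  have hz0 : z ^ n ≠ 0 := pow_ne_zero _ (norm_pos_iff.1 (hρ.trans_le hz))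
  have h1 := hu (-(z ^ n)⁻¹ • y) (E.smul_mem _ hy)
  have h2 : z ^ n • u + y = z ^ n • (u - -(z ^ n)⁻¹ • y) := by
    rw [smul_sub, smul_smul, mul_neg, mul_inv_cancel₀ hz0]; simp
  rw [h2, norm_smul, norm_pow]
  calc ρ ^ n ≤ ‖z‖ ^ n := by gcongr
    _ ≤ _ := le_mul_of_one_le_right (by positivity) h1

lemma QuasiCompactRate.no_increasing_chain (hT : QuasiCompactRate T μ) (hμ : 0 < μ) {ρ : ℝ}
    (hρ : μ < ρ) {E : ℕ → Submodule ℂ B} {z : ℕ → ℂ} (hcl : ∀ k, IsClosed (E k : Set B))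
    (hlt : ∀ k, E k < E (k + 1)) (hTE : ∀ k, ∀ x ∈ E k, T x ∈ E k) (hz : ∀ k, ρ ≤ ‖z k‖)
    (hTz : ∀ k, ∀ x ∈ E (k + 1), T x - z k • x ∈ E k) : False := by
  choose u huE hu3 hud using fun k => exists_riesz_in (hcl k) (hlt k)
  have hmono : Monotone E := monotone_nat_of_le_succ fun k => (hlt k).le
  refine hT.not_separated hμ hρ hu3 fun n a b hab => ?_
  have h1 := pow_apply_sub_mem (hTE b) (hTz b) (huE b) n
  have h2 : (T ^ n) (u a) ∈ E b := pow_apply_mem (hTE b) (hmono (Nat.succ_le_of_lt hab) (huE a)) n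
  have h3 := pow_le_norm_smul_add (hμ.trans hρ) (hz b) (hud b) n ((E b).sub_mem h1 h2)
  convert h3 using 2
  rw [map_sub]; abel

lemma QuasiCompactRate.no_decreasing_chain (hT : QuasiCompactRate T μ) (hμ : 0 < μ) {z : ℂ}
    (hz : μ < ‖z‖) {E : ℕ → Submodule ℂ B} (hcl : ∀ k, IsClosed (E k : Set B))
    (hlt : ∀ k, E (k + 1) < E k) (hTE : ∀ k, ∀ x ∈ E k, T x ∈ E k)
    (hTz : ∀ k, ∀ x ∈ E k, T x - z • x ∈ E (k + 1)) : False := by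
  choose u huE hu3 hud using fun k => exists_riesz_in (hcl (k + 1)) (hlt k)
  have hanti : Antitone E := antitone_nat_of_succ_le fun k => (hlt k).le
  refine hT.not_separated hμ hz hu3 fun n a b hab => ?_
  have h1 := pow_apply_sub_mem (hTE (a + 1)) (hTz a) (huE a) n
  have h2 : (T ^ n) (u b) ∈ E (a + 1) :=
    pow_apply_mem (hTE (a + 1)) (hanti (Nat.succ_le_of_lt hab) (huE b)) n
  have h3 := pow_le_norm_smul_add (hμ.trans hz) le_rfl (hud a) n ((E (a + 1)).sub_mem h1 h2)
  have h4 : z ^ n • u a + ((T ^ n) (u a) - z ^ n • u a - (T ^ n) (u b)) =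
      -((T ^ n) (u b - u a)) := by
    rw [map_sub]; abel
  rwa [h4, norm_neg] at h3

lemma QuasiCompactRate.exists_norm_le (hT : QuasiCompactRate T μ) (hμ : 0 < μ) {z : ℂ}
    (hz : μ < ‖z‖) : ∃ (n k : ℕ) (F : B →L[ℂ] (Fin k → ℂ)) (c : ℝ), 0 < c ∧
      ∀ x, c * ‖x‖ ≤ ‖(T ^ n) x - z ^ n • x‖ + ‖F x‖ := by
  obtain ⟨n, k, F, hF⟩ := hT.exists_pow_le hμ hz (ε := 1 / 2) (by norm_num)
  refine ⟨n, k, F, 1 / 2 * ‖z‖ ^ n, by have := hμ.trans hz; positivity, fun x => ?_⟩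
  have h1 := hF x
  have h2 : ‖z ^ n • x‖ ≤ ‖(T ^ n) x‖ + ‖(T ^ n) x - z ^ n • x‖ := by
    have := norm_sub_le ((T ^ n) x) ((T ^ n) x - z ^ n • x)
    simpa using this
  rw [norm_smul, norm_pow] at h2
  linarith

lemma exists_norm_pow_apply_sub_le (T : B →L[ℂ] B) (z : ℂ) (n : ℕ) :
    ∃ D : ℝ, 0 ≤ D ∧ ∀ x, ‖(T ^ n) x - z ^ n • x‖ ≤ D * ‖T x - z • x‖ := by
  induction n with
  | zero => exact ⟨0, le_rfl, by simp⟩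
  | succ n ih =>
    obtain ⟨D, hD, h⟩ := ih
    refine ⟨‖T‖ * D + ‖z ^ n‖, by positivity, fun x => ?_⟩
    have : (T ^ (n + 1)) x - z ^ (n + 1) • x =
        T ((T ^ n) x - z ^ n • x) + z ^ n • (T x - z • x) := by
      rw [pow_succ' T, mul_apply_eq_comp, map_sub, map_smul, smul_sub, smul_smul,
        pow_succ]
      abel
    rw [this]
    refine (norm_add_le _ _).trans ?_
    rw [norm_smul, add_mul, mul_assoc]
    gcongr
    exact (T.le_opNorm _).trans (by gcongr; exact h x)

lemma QuasiCompactRate.exists_norm_le_sub_smul [CompleteSpace B] (hT : QuasiCompactRate T μ)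
    (hμ : 0 < μ) {z : ℂ} (hz : μ < ‖z‖) (hinj : ∀ x, T x = z • x → x = 0) :
    ∃ c : ℝ, 0 < c ∧ ∀ x, c * ‖x‖ ≤ ‖T x - z • x‖ := by
  by_contra! hcon
  obtain ⟨n, k, F, c, hc, hF⟩ := hT.exists_norm_le hμ hz
  obtain ⟨D, hD, hDn⟩ := exists_norm_pow_apply_sub_le T z n
  have hseq : ∀ i : ℕ, ∃ x : B, ‖x‖ = 1 ∧ ‖T x - z • x‖ < 1 / ((i : ℝ) + 1) := fun i => by
    obtain ⟨x, hx⟩ := hcon (1 / ((i : ℝ) + 1)) (by positivity)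
    have hx0 : x ≠ 0 := by rintro rfl; simp at hx
    have hxn : 0 < ‖x‖ := norm_pos_iff.2 hx0
    refine ⟨((‖x‖⁻¹ : ℝ) : ℂ) • x, ?_, ?_⟩
    · rw [norm_smul, Complex.norm_real, Real.norm_of_nonneg (by positivity)]
      field_simp
    · rw [map_smul, smul_comm z, ← smul_sub, norm_smul, Complex.norm_real,
        Real.norm_of_nonneg (by positivity), inv_mul_lt_iff₀ hxn]
      linarith
  choose x hx1 hx2 using hseq
  have hlim0 : Tendsto (fun i => T (x i) - z • x i) atTop (nhds 0) :=
    squeeze_zero_norm (fun i => (hx2 i).le) tendsto_one_div_add_atTop_nhds_zero_nat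
  have hmem : ∀ i, F (x i) ∈ Metric.closedBall (0 : Fin k → ℂ) ‖F‖ := fun i => by
    rw [mem_closedBall_zero_iff]
    simpa [hx1 i] using F.le_opNorm (x i)
  obtain ⟨y, -, φ, hφ, hlim⟩ := (isCompact_closedBall (0 : Fin k → ℂ) _).tendsto_subseq hmem
  have hlim1 := (hlim0.comp hφ.tendsto_atTop)
  have hcau : CauchySeq (x ∘ φ) := by
    rw [Metric.cauchySeq_iff]
    intro ε hε
    obtain ⟨M1, h1⟩ := Metric.cauchySeq_iff.1 hlim.cauchySeq (c * ε / 2) (by positivity)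
    obtain ⟨M2, h2⟩ := Metric.cauchySeq_iff.1 hlim1.cauchySeq (c * ε / 2 / (D + 1))
      (by positivity)
    refine ⟨max M1 M2, fun a ha b hb => ?_⟩
    have h1' := h1 a (le_of_max_le_left ha) b (le_of_max_le_left hb)
    have h2' := h2 a (le_of_max_le_right ha) b (le_of_max_le_right hb)
    rw [dist_eq_norm] at h1' h2' ⊢
    simp only [Function.comp] at h1' h2' ⊢
    rw [← map_sub] at h1'
    have h3 := hF (x (φ a) - x (φ b))
    have h4 := hDn (x (φ a) - x (φ b))
    have h5 : T (x (φ a) - x (φ b)) - z • (x (φ a) - x (φ b)) =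
        T (x (φ a)) - z • x (φ a) - (T (x (φ b)) - z • x (φ b)) := by
      rw [map_sub, smul_sub]; abel
    rw [h5] at h4
    rw [lt_div_iff₀ (by positivity)] at h2'
    have h6 := norm_nonneg (T (x (φ a)) - z • x (φ a) - (T (x (φ b)) - z • x (φ b)))
    have h7 : c * ‖x (φ a) - x (φ b)‖ < c * ε := by nlinarith
    exact lt_of_mul_lt_mul_left h7 hc.le
  obtain ⟨w, hw⟩ := cauchySeq_tendsto_of_complete hcau
  have hTw : Tendsto (fun i => T ((x ∘ φ) i) - z • (x ∘ φ) i) atTop (nhds (T w - z • w)) :=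
    ((T.continuous.tendsto w).comp hw).sub (hw.const_smul z)
  have hw0 : w = 0 := hinj w (sub_eq_zero.1 (tendsto_nhds_unique hTw hlim1))
  have hw1 : ‖w‖ = 1 := tendsto_nhds_unique hw.norm (by simp [hx1])
  rw [hw0, norm_zero] at hw1
  exact zero_ne_one hw1

lemma QuasiCompactRate.exists_eigenvector [CompleteSpace B] (hT : QuasiCompactRate T μ)
    (hμ : 0 < μ) {z : ℂ} (hz : μ < ‖z‖) (hs : z ∈ spectrum ℂ T) :
    ∃ x : B, x ≠ 0 ∧ T x = z • x := by
  by_contra! hcon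
  have hinj : ∀ x, T x = z • x → x = 0 := fun x hx => by
    by_contra h; exact hcon x h hx
  obtain ⟨c, hc, hcx⟩ := hT.exists_norm_le_sub_smul hμ hz hinj
  set A : B →L[ℂ] B := T - z • ContinuousLinearMap.id ℂ B with hA
  have hAx : ∀ x, A x = T x - z • x := fun x => by simp [hA]
  have hAinj : Function.Injective A := by
    refine (injective_iff_map_eq_zero A).2 fun x hx => hinj x ?_
    rw [hAx] at hx; exact sub_eq_zero.1 hx
  have hpow : ∀ (k : ℕ) x, c ^ k * ‖x‖ ≤ ‖(A ^ k) x‖ := by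
    intro k
    induction k with
    | zero => simp
    | succ k ih =>
      intro x
      rw [pow_succ' A, mul_apply_eq_comp, hAx, pow_succ', mul_assoc]
      exact (mul_le_mul_of_nonneg_left (ih x) hc.le).trans (hcx _)
  have hclosed : ∀ k, IsClosed ((LinearMap.range (A ^ k).toLinearMap : Submodule ℂ B) : Set B) := by
    intro k
    have hanti : AntilipschitzWith (Real.toNNReal (c ^ k)⁻¹) (A ^ k) := by
      refine ContinuousLinearMap.antilipschitz_of_bound _ fun x => ?_
      rw [Real.coe_toNNReal _ (by positivity), ← div_eq_inv_mul, le_div_iff₀ (by positivity),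
        mul_comm]
      exact hpow k x
    exact hanti.isClosed_range (A ^ k).uniformContinuous
  have hsurj : ¬ Function.Surjective A := by
    intro hsurj
    refine spectrum.mem_iff.1 hs ?_
    have : (algebraMap ℂ (B →L[ℂ] B)) z - T = -A := by
      ext x; simp [hA, Algebra.algebraMap_eq_smul_one]
    rw [this]
    exact (ContinuousLinearMap.isUnit_iff_bijective.2 ⟨hAinj, hsurj⟩).neg
  obtain ⟨x, hx⟩ := not_forall.1 hsurj
  have hcomm : ∀ (k : ℕ) y, T ((A ^ k) y) = (A ^ k) (T y) := by
    intro k y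
    have hc1 : Commute T A := by
      rw [hA]
      refine (Commute.refl T).sub_right ?_
      ext y; simp
    have := DFunLike.congr_fun ((hc1.pow_right k).eq) y
    simpa using this
  refine hT.no_decreasing_chain hμ hz (E := fun k => LinearMap.range (A ^ k).toLinearMap)
    hclosed ?_ ?_ ?_
  · intro k
    refine SetLike.lt_iff_le_and_exists.2 ⟨?_, (A ^ k) x, ⟨x, rfl⟩, ?_⟩
    · rintro _ ⟨y, rfl⟩
      exact ⟨A y, by simp [pow_succ]⟩
    · rintro ⟨y, hy⟩
      refine hx ⟨y, ?_⟩
      have hy' : (A ^ k) (A y) = (A ^ k) x := by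
        rw [← hy, ← mul_apply_eq_comp, ← pow_succ]; rfl
      have hk : Function.Injective (A ^ k) := by
        refine (injective_iff_map_eq_zero _).2 fun w hw => ?_
        have := hpow k w
        rw [hw, norm_zero] at this
        have h0 : 0 < c ^ k := by positivity
        exact norm_le_zero_iff.1 (by nlinarith)
      exact hk hy'
  · rintro k _ ⟨y, rfl⟩
    exact ⟨T y, (hcomm k y).symm⟩
  · rintro k _ ⟨y, rfl⟩
    refine ⟨y, ?_⟩
    change (A ^ (k + 1)) y = T ((A ^ k) y) - z • (A ^ k) y
    rw [← hAx, pow_succ' A, mul_apply_eq_comp]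

lemma QuasiCompactRate.finite_spectrum [CompleteSpace B] (hT : QuasiCompactRate T μ)
    (hμ : 0 < μ) {ρ : ℝ} (hρ : μ < ρ) : {z ∈ spectrum ℂ T | ρ ≤ ‖z‖}.Finite := by
  by_contra hinf
  set z := Set.Infinite.natEmbedding _ hinf with hzdef
  have hz1 : ∀ k, (z k : ℂ) ∈ spectrum ℂ T := fun k => (z k).2.1
  have hz2 : ∀ k, ρ ≤ ‖(z k : ℂ)‖ := fun k => (z k).2.2
  have hzinj : Function.Injective fun k => (z k : ℂ) :=
    Subtype.val_injective.comp z.injective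
  choose x hx0 hx using fun k => hT.exists_eigenvector hμ (hρ.trans_le (hz2 k)) (hz1 k)
  have hli : LinearIndependent ℂ x :=
    Module.End.eigenvectors_linearIndependent' T.toLinearMap _ hzinj x fun k =>
      ⟨Module.End.mem_eigenspace_iff.2 (hx k), hx0 k⟩
  set E : ℕ → Submodule ℂ B := fun k => Submodule.span ℂ (x '' Set.Iio k) with hE
  have hEmono : Monotone E := fun a b hab =>
    Submodule.span_mono (Set.image_mono (Set.Iio_subset_Iio hab))
  have hTE : ∀ k, ∀ w ∈ E k, T w ∈ E k := by
    intro k w hw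
    have : E k ≤ (E k).comap T.toLinearMap := by
      refine Submodule.span_le.2 ?_
      rintro _ ⟨i, hi, rfl⟩
      change T (x i) ∈ E k
      rw [hx]
      exact (E k).smul_mem _ (Submodule.subset_span ⟨i, hi, rfl⟩)
    exact this hw
  refine hT.no_increasing_chain hμ hρ (E := E) (z := fun k => (z k : ℂ)) ?_ ?_ hTE hz2 ?_
  · intro k
    have : FiniteDimensional ℂ (E k) :=
      FiniteDimensional.span_of_finite ℂ ((Set.finite_Iio k).image x)
    exact (E k).closed_of_finiteDimensional
  · intro k
    refine SetLike.lt_iff_le_and_exists.2 ⟨hEmono (Nat.le_succ k), x k,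
      Submodule.subset_span ⟨k, Nat.lt_succ_self k, rfl⟩, ?_⟩
    exact hli.notMem_span_image (by simp)
  · intro k w hw
    have : E (k + 1) ≤ (E k).comap (T.toLinearMap - (z k : ℂ) • LinearMap.id) := by
      refine Submodule.span_le.2 ?_
      rintro _ ⟨i, hi, rfl⟩
      change T (x i) - (z k : ℂ) • x i ∈ E k
      rcases (Nat.lt_succ_iff_lt_or_eq.1 hi) with h | rfl
      · have hm : x i ∈ E k := Submodule.subset_span ⟨i, h, rfl⟩
        exact (E k).sub_mem (hTE k _ hm) ((E k).smul_mem _ hm)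
      · rw [hx, sub_self]; exact (E i).zero_mem
    exact this hw

lemma QuasiCompactRate.isolated [CompleteSpace B] (hT : QuasiCompactRate T μ)
    (hμ : 0 < μ) {z : ℂ} (hz : μ < ‖z‖) :
    ∃ ε : ℝ, 0 < ε ∧ ∀ w ∈ spectrum ℂ T, w ≠ z → ε ≤ ‖w - z‖ := by
  obtain ⟨ρ, h1, h2⟩ := exists_between hz
  have hfin := (hT.finite_spectrum hμ h1).sdiff (t := {z})
  have hopen : IsOpen ({w : ℂ | ρ < ‖w‖} ∩ ({w ∈ spectrum ℂ T | ρ ≤ ‖w‖} \ {z})ᶜ) :=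
    (isOpen_lt continuous_const continuous_norm).inter hfin.isClosed.isOpen_compl
  obtain ⟨ε, hε, hball⟩ := Metric.isOpen_iff.1 hopen z ⟨h2, by simp⟩
  refine ⟨ε, hε, fun w hw hwz => ?_⟩
  by_contra! hlt
  have hmem := hball (show w ∈ Metric.ball z ε by rwa [mem_ball_iff_norm])
  exact hmem.2 ⟨⟨hw, le_of_lt hmem.1⟩, hwz⟩

lemma QuasiCompactRate.finiteDimensional_generalized (hT : QuasiCompactRate T μ)
    (hμ : 0 < μ) {z : ℂ} (hz : μ < ‖z‖) :
    FiniteDimensional ℂ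
      ↥(⨆ k : ℕ, LinearMap.ker ((T.toLinearMap - z • (LinearMap.id : B →ₗ[ℂ] B)) ^ k)) := by
  set f : B →ₗ[ℂ] B := T.toLinearMap - z • (LinearMap.id : B →ₗ[ℂ] B) with hf
  have hfx : ∀ x, f x = T x - z • x := fun x => by simp [hf]
  set A : B →L[ℂ] B := T - z • ContinuousLinearMap.id ℂ B with hA
  have hAf : ∀ (k : ℕ) x, (A ^ k) x = (f ^ k) x := by
    intro k
    induction k with
    | zero => simp
    | succ k ih =>
      intro x
      rw [pow_succ', pow_succ', mul_apply_eq_comp, Module.End.mul_apply, ih]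
      simp [hA, hf]
  have hker1 : (LinearMap.ker f).FG := by
    obtain ⟨n, k, F, c, hc, hF⟩ := hT.exists_norm_le hμ hz
    have hinj : Function.Injective (F.toLinearMap.domRestrict (LinearMap.ker f)) := by
      refine (injective_iff_map_eq_zero _).2 ?_
      rintro ⟨x, hx⟩ hFx
      have hTx : T x - z • x = 0 := by rw [← hfx]; exact hx
      obtain ⟨D, -, hD⟩ := exists_norm_pow_apply_sub_le T z n
      have h1 := hD x
      have h2 := hF x
      have h3 : F x = 0 := hFx
      rw [hTx, norm_zero, mul_zero] at h1
      rw [h3, norm_zero] at h2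
      have : x = 0 := norm_le_zero_iff.1 (by nlinarith [norm_nonneg x])
      exact Subtype.ext this
    have := FiniteDimensional.of_injective _ hinj
    exact Module.Finite.iff_fg.1 this
  have hker : ∀ k : ℕ, (LinearMap.ker (f ^ k)).FG := by
    intro k
    induction k with
    | zero =>
      have : LinearMap.ker (f ^ 0) = ⊥ := by
        rw [pow_zero]; exact LinearMap.ker_id
      rw [this]; exact Submodule.fg_bot
    | succ k ih =>
      have hfd : FiniteDimensional ℂ (LinearMap.ker (f ^ k)) := Module.Finite.iff_fg.2 ih
      have hfd1 : FiniteDimensional ℂ (LinearMap.ker f) := Module.Finite.iff_fg.2 hker1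
      refine Submodule.fg_of_fg_map_of_fg_inf_ker f ?_ ?_
      · have hle : (LinearMap.ker (f ^ (k + 1))).map f ≤ LinearMap.ker (f ^ k) := by
          rintro _ ⟨x, hx, rfl⟩
          have hx' : (f ^ (k + 1)) x = 0 := hx
          rwa [pow_succ, Module.End.mul_apply] at hx'
        exact Module.Finite.iff_fg.1 (Submodule.finiteDimensional_of_le hle)
      · exact Module.Finite.iff_fg.1 (Submodule.finiteDimensional_of_le inf_le_right)
  have hmono : Monotone fun k => LinearMap.ker (f ^ k) := by
    refine monotone_nat_of_le_succ fun k x hx => ?_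
    have hx' : (f ^ k) x = 0 := hx
    change (f ^ (k + 1)) x = 0
    rw [pow_succ', Module.End.mul_apply, hx', map_zero]
  have hstab : ∃ k, LinearMap.ker (f ^ k) = LinearMap.ker (f ^ (k + 1)) := by
    by_contra! hne
    refine hT.no_increasing_chain hμ hz (E := fun k => LinearMap.ker (f ^ k)) (z := fun _ => z)
      ?_ (fun k => lt_of_le_of_ne (hmono (Nat.le_succ k)) (hne k)) ?_ (fun _ => le_rfl) ?_
    · intro k
      have : FiniteDimensional ℂ (LinearMap.ker (f ^ k)) := Module.Finite.iff_fg.2 (hker k)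
      exact Submodule.closed_of_finiteDimensional _
    · intro k x hx
      have hx' : (f ^ k) x = 0 := hx
      have h1 : T x = f x + z • x := by rw [hfx]; abel
      change (f ^ k) (T x) = 0
      rw [h1, map_add, map_smul, hx', smul_zero, add_zero, ← Module.End.mul_apply, ← pow_succ,
        pow_succ', Module.End.mul_apply, hx', map_zero]
    · intro k x hx
      have hx' : (f ^ (k + 1)) x = 0 := hx
      rw [← hfx]
      rwa [pow_succ, Module.End.mul_apply] at hx'
  obtain ⟨k, hk⟩ := hstab
  have hall : ∀ m, LinearMap.ker (f ^ (k + m)) ≤ LinearMap.ker (f ^ k) := by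
    intro m
    induction m with
    | zero => exact le_rfl
    | succ m ih =>
      intro x hx
      have hx' : (f ^ (k + m + 1)) x = 0 := hx
      rw [pow_succ, Module.End.mul_apply] at hx'
      have h2 : f x ∈ LinearMap.ker (f ^ k) := ih hx'
      rw [hk]
      change (f ^ (k + 1)) x = 0
      rw [pow_succ, Module.End.mul_apply]
      exact h2
  have hsup : (⨆ m : ℕ, LinearMap.ker (f ^ m)) ≤ LinearMap.ker (f ^ k) :=
    iSup_le fun m => (hmono (Nat.le_add_left m k)).trans (hall m)
  have : FiniteDimensional ℂ (LinearMap.ker (f ^ k)) := Module.Finite.iff_fg.2 (hker k)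
  exact Submodule.finiteDimensional_of_le hsup

end QuasiCompact
section HeisenbergCalculus

lemma hmul_assoc (a b c : Heis) : hmul (hmul a b) c = hmul a (hmul b c) := by
  simp only [hmul, Prod.mk.injEq]
  exact ⟨by ring, by ring, by ring⟩

lemma hflow_eq (U : ℝ × ℝ × ℝ) (t : ℝ) (m : Heis) :
    hflow U t m = (m.1 + t * U.1, m.2.1 + t * U.2.1,
      m.2.2 + (t * U.2.2 + t * U.1 * (t * U.2.1) / 2) + m.1 * (t * U.2.1)) := rfl

lemma hflow_hmul (U : ℝ × ℝ × ℝ) (t : ℝ) (γ m : Heis) :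
    hflow U t (hmul γ m) = hmul γ (hflow U t m) := hmul_assoc _ _ _

lemma hflow_zero (U : ℝ × ℝ × ℝ) (m : Heis) : hflow U 0 m = m := by
  simp [hflow_eq]

lemma hflow_add (U : ℝ × ℝ × ℝ) (s a : ℝ) (m : Heis) :
    hflow U (s + a) m = hflow U a (hflow U s m) := by
  simp only [hflow_eq, Prod.mk.injEq]
  exact ⟨by ring, by ring, by ring⟩

lemma hflow_Zvec_comm (U : ℝ × ℝ × ℝ) (c t : ℝ) (m : Heis) :
    hflow U t (hflow Zvec c m) = hflow Zvec c (hflow U t m) := by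
  simp only [hflow_eq, Zvec, Prod.mk.injEq]
  exact ⟨by ring, by ring, by ring⟩

lemma hflow_comm {V W : ℝ × ℝ × ℝ} (hVW : hbracket V W = Zvec) (a t : ℝ) (m : Heis) :
    hflow W t (hflow V a m) = hflow Zvec (a * t) (hflow V a (hflow W t m)) := by
  have h : V.1 * W.2.1 - W.1 * V.2.1 = 1 := by
    simpa [hbracket, Zvec] using hVW
  simp only [hflow_eq, Zvec, Prod.mk.injEq]
  refine ⟨by ring, by ring, ?_⟩
  linear_combination (a * t) * h

lemma contDiff_hflow (U : ℝ × ℝ × ℝ) :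
    ContDiff ℝ (⊤ : ℕ∞) fun x : ℝ × Heis => hflow U x.1 x.2 := by
  simp only [hflow_eq]
  fun_prop

lemma contDiff_hflow_time (U : ℝ × ℝ × ℝ) (m : Heis) :
    ContDiff ℝ (⊤ : ℕ∞) fun t : ℝ => hflow U t m :=
  (contDiff_hflow U).comp (contDiff_id.prodMk contDiff_const)

lemma hasDerivAt_hflow (U : ℝ × ℝ × ℝ) (m : Heis) :
    HasDerivAt (fun t => hflow U t m) (U.1, U.2.1, U.2.2 + m.1 * U.2.1) 0 := by
  simp only [hflow_eq]
  have hid := hasDerivAt_id (0 : ℝ)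
  have h1 := (hid.mul_const U.1).const_add m.1
  have h2 := (hid.mul_const U.2.1).const_add m.2.1
  have h3 := ((((hid.mul_const U.2.2).add
    (((hid.mul_const U.1).mul (hid.mul_const U.2.1)).div_const 2)).const_add m.2.2).add
    ((hid.mul_const U.2.1).const_mul m.1))
  refine (h1.prodMk (h2.prodMk h3)).congr_deriv ?_
  simp

variable {h : Heis → ℂ} {U V W : ℝ × ℝ × ℝ}

lemma hasDerivAt_comp_hflow_zero (hh : ContDiff ℝ (⊤ : ℕ∞) h) (U : ℝ × ℝ × ℝ) (m : Heis) :
    HasDerivAt (fun t => h (hflow U t m)) (VF U h m) 0 := by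
  have hd : DifferentiableAt ℝ (fun t => h (hflow U t m)) 0 :=
    ((hh.comp (contDiff_hflow_time U m)).differentiable (by simp)).differentiableAt
  exact hd.hasDerivAt

lemma hasDerivAt_comp_hflow (hh : ContDiff ℝ (⊤ : ℕ∞) h) (U : ℝ × ℝ × ℝ) (m : Heis) (s : ℝ) :
    HasDerivAt (fun t => h (hflow U t m)) (VF U h (hflow U s m)) s := by
  have h1 := hasDerivAt_comp_hflow_zero hh U (hflow U s m)
  rw [← sub_self s] at h1
  refine (h1.comp_sub_const s s).congr_of_eventuallyEq (Eventually.of_forall fun t => ?_)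
  simp only
  rw [← hflow_add]
  congr 2
  ring

lemma VF_eq_fderiv (hh : ContDiff ℝ (⊤ : ℕ∞) h) (U : ℝ × ℝ × ℝ) (m : Heis) :
    VF U h m = fderiv ℝ h m (U.1, U.2.1, U.2.2 + m.1 * U.2.1) := by
  have h1 : HasFDerivAt h (fderiv ℝ h m) (hflow U 0 m) := by
    rw [hflow_zero]
    exact (hh.differentiable (by simp)).differentiableAt.hasFDerivAt
  exact (h1.comp_hasDerivAt 0 (hasDerivAt_hflow U m)).deriv

lemma contDiff_VF (hh : ContDiff ℝ (⊤ : ℕ∞) h) (U : ℝ × ℝ × ℝ) :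
    ContDiff ℝ (⊤ : ℕ∞) (VF U h) := by
  have : VF U h = fun m : Heis => fderiv ℝ h m (U.1, U.2.1, U.2.2 + m.1 * U.2.1) :=
    funext (VF_eq_fderiv hh U)
  rw [this]
  refine (hh.fderiv_right (by simp)).clm_apply ?_
  fun_prop

lemma VF_add {h h' : Heis → ℂ} (hh : ContDiff ℝ (⊤ : ℕ∞) h) (hh' : ContDiff ℝ (⊤ : ℕ∞) h')
    (U : ℝ × ℝ × ℝ) : VF U (h + h') = VF U h + VF U h' := by
  funext m
  exact ((hasDerivAt_comp_hflow_zero hh U m).add (hasDerivAt_comp_hflow_zero hh' U m)).deriv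

lemma VF_smul (hh : ContDiff ℝ (⊤ : ℕ∞) h) (c : ℂ) (U : ℝ × ℝ × ℝ) :
    VF U (c • h) = c • VF U h := by
  funext m
  exact ((hasDerivAt_comp_hflow_zero hh U m).const_smul c).deriv

lemma VF_hmul {γ : Heis} (hγ : ∀ m, h (hmul γ m) = h m) (m : Heis) :
    VF U h (hmul γ m) = VF U h m := by
  simp only [VF, hflow_hmul, hγ]

variable {K : ℕ} {N : ℤ}

/-- The eigenvalue by which the central field `Z` acts on `C^∞_N`. -/
def centralChar (K : ℕ) (N : ℤ) : ℂ := 2 * Real.pi * Complex.I * N * K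

lemma norm_exp_centralChar_mul (K : ℕ) (N : ℤ) (c : ℝ) :
    ‖Complex.exp (centralChar K N * c)‖ = 1 := by
  rw [Complex.norm_exp]
  simp [centralChar]

lemma CN.contDiff (hh : CN K N h) : ContDiff ℝ (⊤ : ℕ∞) h := hh.1.1

lemma CN.hmul_eq (hh : CN K N h) {γ : Heis} (hγ : γ ∈ GammaK K) (m : Heis) :
    h (hmul γ m) = h m := hh.1.2 γ hγ m

lemma CN.hflow_Zvec (hh : CN K N h) (c : ℝ) (m : Heis) :
    h (hflow Zvec c m) = Complex.exp (centralChar K N * c) * h m := by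
  have hd : ∀ t : ℝ, HasDerivAt
      (fun t : ℝ => Complex.exp (-(centralChar K N * t)) * h (hflow Zvec t m)) 0 t := by
    intro t
    have h1 := hasDerivAt_comp_hflow hh.contDiff Zvec m t
    have h2 : HasDerivAt (fun t : ℝ => -(centralChar K N * (t : ℂ))) (-(centralChar K N)) t := by
      have := ((hasDerivAt_id t).ofReal_comp.const_mul (centralChar K N)).fun_neg
      simpa using this
    refine (h2.cexp.mul h1).congr_deriv ?_
    rw [hh.2]
    simp only [centralChar]
    ring
  have h0 := is_const_of_deriv_eq_zero (fun t => (hd t).differentiableAt) (fun t => (hd t).deriv)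
    c 0
  simp only [Complex.ofReal_zero, mul_zero, neg_zero, Complex.exp_zero, one_mul,
    hflow_zero] at h0
  rw [← h0, ← mul_assoc, ← Complex.exp_add]
  simp

lemma CN.of_hflow_Zvec (hs : SmoothM K h)
    (hz : ∀ (c : ℝ) m, h (hflow Zvec c m) = Complex.exp (centralChar K N * c) * h m) :
    CN K N h := by
  refine ⟨hs, funext fun m => ?_⟩
  have h2 : HasDerivAt (fun t : ℝ => centralChar K N * (t : ℂ)) (centralChar K N) 0 := by
    simpa using ((hasDerivAt_id (0 : ℝ)).ofReal_comp.const_mul (centralChar K N))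
  have h3 := (h2.cexp.mul_const (h m)).deriv
  simp only [VF, hz]
  rw [h3]
  simp [centralChar]

lemma CN.VF (hh : CN K N h) (U : ℝ × ℝ × ℝ) : CN K N (VF U h) := by
  refine CN.of_hflow_Zvec ⟨contDiff_VF hh.contDiff U, fun γ hγ m =>
    VF_hmul (fun x => hh.hmul_eq hγ x) m⟩ fun c m => ?_
  have h1 := (hasDerivAt_comp_hflow_zero hh.contDiff U m).const_mul
    (Complex.exp (centralChar K N * c))
  rw [← h1.deriv]
  simp only [_root_.VF, hflow_Zvec_comm, hh.hflow_Zvec]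

lemma CN.iterate_VF (hh : CN K N h) (U : ℝ × ℝ × ℝ) (j : ℕ) : CN K N ((_root_.VF U)^[j] h) := by
  induction j with
  | zero => exact hh
  | succ j ih => rw [Function.iterate_succ_apply']; exact ih.VF U

lemma CN.add {h h' : Heis → ℂ} (hh : CN K N h) (hh' : CN K N h') : CN K N (h + h') :=
  CN.of_hflow_Zvec ⟨hh.contDiff.add hh'.contDiff, fun γ hγ m => by
    simp [hh.hmul_eq hγ, hh'.hmul_eq hγ]⟩ fun c m => by
    simp [hh.hflow_Zvec, hh'.hflow_Zvec, mul_add]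

lemma CN.smul (hh : CN K N h) (c : ℂ) : CN K N (c • h) :=
  CN.of_hflow_Zvec ⟨hh.contDiff.const_smul c, fun γ hγ m => by
    simp [hh.hmul_eq hγ]⟩ fun a m => by
    simp [hh.hflow_Zvec]; ring

lemma CN.zero : CN K N 0 :=
  CN.of_hflow_Zvec ⟨contDiff_const, fun _ _ _ => rfl⟩ fun _ _ => by simp

lemma CN.iterate_VF_add {h h' : Heis → ℂ} (hh : CN K N h) (hh' : CN K N h') (U : ℝ × ℝ × ℝ)
    (j : ℕ) : (_root_.VF U)^[j] (h + h') = (_root_.VF U)^[j] h + (_root_.VF U)^[j] h' := by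
  induction j with
  | zero => rfl
  | succ j ih =>
    simp only [Function.iterate_succ_apply', ih]
    exact VF_add (hh.iterate_VF U j).contDiff (hh'.iterate_VF U j).contDiff U

lemma CN.iterate_VF_smul (hh : CN K N h) (c : ℂ) (U : ℝ × ℝ × ℝ)
    (j : ℕ) : (_root_.VF U)^[j] (c • h) = c • (_root_.VF U)^[j] h := by
  induction j with
  | zero => rfl
  | succ j ih =>
    simp only [Function.iterate_succ_apply', ih]
    exact VF_smul (hh.iterate_VF U j).contDiff c U

/-- The variation of `h` along `V` before flowing along `W`. -/
lemma CN.hasDerivAt_hflow_hflow (hh : CN K N h) (hVW : hbracket V W = Zvec) (s t : ℝ) (m : Heis) :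
    HasDerivAt (fun a => h (hflow W t (hflow V a m)))
      (_root_.VF V h (hflow W t (hflow V s m)) +
        centralChar K N * t * h (hflow W t (hflow V s m))) s := by
  set x := hflow W t (hflow V s m) with hx
  have h1 : HasDerivAt (fun a => h (hflow V a x)) (_root_.VF V h x) 0 :=
    hasDerivAt_comp_hflow_zero hh.contDiff V x
  have h2 : HasDerivAt (fun a : ℝ => centralChar K N * ((a * t : ℝ) : ℂ))
      (centralChar K N * t) 0 := by
    simpa using (((hasDerivAt_id (0 : ℝ)).mul_const t).ofReal_comp.const_mul (centralChar K N))
  have h3 := h2.cexp.mul h1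
  have h4 : HasDerivAt (fun a : ℝ => Complex.exp (centralChar K N * ((a * t : ℝ) : ℂ)) *
      h (hflow V a x)) (_root_.VF V h x + centralChar K N * t * h x) (s - s) := by
    rw [sub_self]
    refine h3.congr_deriv ?_
    simp [hflow_zero]
    ring
  refine (h4.comp_sub_const s s).congr_of_eventuallyEq (Eventually.of_forall fun a => ?_)
  simp only
  rw [← hh.hflow_Zvec, hx, ← hflow_comm hVW, ← hflow_add]
  congr 3
  ring

lemma exists_mem_GammaK_hmul_mem (hK : 0 < K) (m : Heis) : ∃ γ ∈ GammaK K,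
    hmul γ m ∈ Set.Icc (0 : ℝ) 1 ×ˢ (Set.Icc (0 : ℝ) 1 ×ˢ Set.Icc (0 : ℝ) 1) := by
  set w : ℝ := m.2.2 - ⌊m.1⌋ * m.2.1 with hw
  have hK' : (0 : ℝ) < K := by exact_mod_cast hK
  refine ⟨_, ⟨-⌊m.1⌋, -⌊m.2.1⌋, -⌊K * w⌋, rfl⟩, ?_⟩
  have h1 := Int.floor_le (K * w)
  have h2 := Int.lt_floor_add_one (K * w)
  have h3 : (1 : ℝ) ≤ K := by exact_mod_cast hK
  have e : ((-⌊K * w⌋ : ℤ) : ℝ) / K + m.2.2 + ((-⌊m.1⌋ : ℤ) : ℝ) * m.2.1 =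
      (K * w - ⌊K * w⌋) / K := by
    push_cast; rw [hw]; field_simp; ring
  refine ⟨⟨?_, ?_⟩, ⟨?_, ?_⟩, ⟨?_, ?_⟩⟩ <;> simp only [hmul]
  · push_cast; linarith [Int.floor_le m.1]
  · push_cast; linarith [Int.lt_floor_add_one m.1]
  · push_cast; linarith [Int.floor_le m.2.1]
  · push_cast; linarith [Int.lt_floor_add_one m.2.1]
  · rw [e]; exact div_nonneg (by linarith) hK'.le
  · rw [e, div_le_one hK']; linarith

lemma isCompact_box : IsCompact
    (Set.Icc (0 : ℝ) 1 ×ˢ (Set.Icc (0 : ℝ) 1 ×ˢ Set.Icc (0 : ℝ) 1) : Set Heis) :=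
  isCompact_Icc.prod (isCompact_Icc.prod isCompact_Icc)

lemma CN.exists_norm_le (hh : CN K N h) (hK : 0 < K) : ∃ C, ∀ m, ‖h m‖ ≤ C := by
  obtain ⟨C, hC⟩ := isCompact_box.exists_bound_of_continuousOn hh.contDiff.continuous.continuousOn
  refine ⟨C, fun m => ?_⟩
  obtain ⟨γ, hγ, hm⟩ := exists_mem_GammaK_hmul_mem hK m
  rw [← hh.hmul_eq hγ m]
  exact hC _ hm

end HeisenbergCalculus
section TestFunctions

variable {δ : ℝ} {η θ : ℝ → ℂ}

lemma TestFun.contDiff (hη : TestFun δ η) : ContDiff ℝ (⊤ : ℕ∞) η := hη.1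

lemma TestFun.continuous (hη : TestFun δ η) : Continuous η := hη.1.continuous

lemma contDiff_nat_of_top {η : ℝ → ℂ} (hη : ContDiff ℝ (⊤ : ℕ∞) η) (k : ℕ) :
    ContDiff ℝ k η := hη.of_le (by exact_mod_cast le_top)

lemma TestFun.iteratedDeriv_eq_zero (hη : TestFun δ η) (k : ℕ) {t : ℝ}
    (ht : t ∉ Set.Ioo (-δ) δ) : iteratedDeriv k η t = 0 := by
  by_contra hne
  refine ht (hη.2.2 (tsupport_iteratedFDeriv_subset (𝕜 := ℝ) k (subset_closure ?_)))
  rw [Function.mem_support]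
  intro h0
  exact hne (by rw [iteratedDeriv_eq_iteratedFDeriv, h0]; rfl)

lemma TestFun.eq_zero (hη : TestFun δ η) {t : ℝ} (ht : t ∉ Set.Ioo (-δ) δ) : η t = 0 := by
  simpa using hη.iteratedDeriv_eq_zero 0 ht

lemma TestFun.exists_norm_iteratedDeriv_le (hη : TestFun δ η) (q : ℕ) :
    ∃ C, 0 ≤ C ∧ ∀ k ≤ q, ∀ t, ‖iteratedDeriv k η t‖ ≤ C := by
  have h1 : ∀ k : ℕ, ∃ C, ∀ t, ‖iteratedDeriv k η t‖ ≤ C := fun k => by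
    obtain ⟨C, hC⟩ := (isCompact_Icc (a := -δ) (b := δ)).exists_bound_of_continuousOn
      ((contDiff_nat_of_top hη.contDiff k).continuous_iteratedDeriv k le_rfl).continuousOn
    refine ⟨max C 0, fun t => ?_⟩
    by_cases ht : t ∈ Set.Ioo (-δ) δ
    · exact (hC t ⟨ht.1.le, ht.2.le⟩).trans (le_max_left _ _)
    · rw [hη.iteratedDeriv_eq_zero k ht, norm_zero]; exact le_max_right _ _
  choose C hC using h1
  have hC0 : ∀ k, 0 ≤ C k := fun k => (norm_nonneg _).trans (hC k 0)
  refine ⟨∑ k ∈ Finset.range (q + 1), C k, Finset.sum_nonneg fun k _ => hC0 k, fun k hk t =>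
    (hC k t).trans ?_⟩
  exact Finset.single_le_sum (fun k _ => hC0 k) (Finset.mem_range.2 (Nat.lt_succ_of_le hk))

lemma TestFun.mul_left {ζ : ℝ → ℂ} (hζ : ContDiff ℝ (⊤ : ℕ∞) ζ) (hη : TestFun δ η) :
    TestFun δ (fun t => ζ t * η t) :=
  ⟨hζ.mul hη.contDiff, hη.2.1.mul_left, (tsupport_mul_subset_right).trans hη.2.2⟩

lemma TestFun.const_smul (hη : TestFun δ η) (c : ℂ) : TestFun δ (fun t => c * η t) :=
  hη.mul_left contDiff_const

/-- Multiplication by a fixed test function is bounded in the `C^q` sense. -/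
lemma TestFun.exists_norm_iteratedDeriv_mul_le (hη : TestFun δ η) (hδ : 0 < δ) (q : ℕ) :
    ∃ C, 0 ≤ C ∧ ∀ (ζ : ℝ → ℂ) (A : ℝ), ContDiff ℝ (⊤ : ℕ∞) ζ →
      (∀ k ≤ q, ∀ t ∈ Set.Icc (-δ) δ, ‖iteratedDeriv k ζ t‖ ≤ A) →
      ∀ k ≤ q, ∀ t, ‖iteratedDeriv k (fun s => ζ s * η s) t‖ ≤ C * A := by
  obtain ⟨C, hC, hb⟩ := hη.exists_norm_iteratedDeriv_le q
  refine ⟨2 ^ q * C, by positivity, fun ζ A hζ hA k hk t => ?_⟩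
  by_cases ht : t ∈ Set.Icc (-δ) δ
  swap
  · rw [(hη.mul_left hζ).iteratedDeriv_eq_zero k fun h => ht ⟨h.1.le, h.2.le⟩, norm_zero]
    exact mul_nonneg (by positivity)
      ((norm_nonneg _).trans (hA 0 (Nat.zero_le _) δ ⟨by linarith, le_rfl⟩))
  have hA0 : 0 ≤ A := (norm_nonneg _).trans (hA 0 (Nat.zero_le _) t ht)
  rw [← norm_iteratedFDeriv_eq_norm_iteratedDeriv]
  refine (norm_iteratedFDeriv_mul_le hζ hη.contDiff t (by exact_mod_cast le_top)).trans ?_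
  calc ∑ i ∈ Finset.range (k + 1), (k.choose i : ℝ) * ‖iteratedFDeriv ℝ i ζ t‖ *
        ‖iteratedFDeriv ℝ (k - i) η t‖
      ≤ ∑ i ∈ Finset.range (k + 1), (k.choose i : ℝ) * A * C := by
        refine Finset.sum_le_sum fun i hi => ?_
        rw [norm_iteratedFDeriv_eq_norm_iteratedDeriv, norm_iteratedFDeriv_eq_norm_iteratedDeriv]
        have hik : i ≤ k := Nat.lt_succ_iff.1 (Finset.mem_range.1 hi)
        gcongr
        · exact hA i (hik.trans hk) t ht
        · exact hb _ ((Nat.sub_le _ _).trans hk) t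
    _ = 2 ^ k * A * C := by
        rw [← Finset.sum_mul, ← Finset.sum_mul]
        congr 2
        exact_mod_cast Nat.sum_range_choose k
    _ ≤ 2 ^ q * C * A := by
        have : (2 : ℝ) ^ k ≤ 2 ^ q := pow_le_pow_right₀ (by norm_num) hk
        nlinarith [mul_nonneg hA0 hC]

lemma CrNorm_le {q : ℕ} {c : ℝ} (hc : 0 ≤ c)
    (h : ∀ k ≤ q, ∀ t, ‖iteratedDeriv k η t‖ ≤ c) : CrNorm q η ≤ 2 ^ q * c := by
  refine Real.iSup_le (fun k => ?_) (by positivity)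
  have h1 : (⨆ t : ℝ, ‖iteratedDeriv (k : ℕ) η t‖) ≤ c :=
    Real.iSup_le (fun t => h k (Nat.lt_succ_iff.1 k.2) t) hc
  have h2 : (2 : ℝ) ^ (q - (k : ℕ)) ≤ 2 ^ q :=
    pow_le_pow_right₀ (by norm_num) (Nat.sub_le _ _)
  calc _ ≤ (2 : ℝ) ^ (q - (k : ℕ)) * c := by gcongr
    _ ≤ _ := by gcongr

lemma TestFun.norm_iteratedDeriv_le_one (hη : TestFun δ η) {q : ℕ} (hq : CrNorm q η ≤ 1) {k : ℕ}
    (hk : k ≤ q) (t : ℝ) : ‖iteratedDeriv k η t‖ ≤ 1 := by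
  obtain ⟨C, -, hC⟩ := hη.exists_norm_iteratedDeriv_le k
  have h1 : ‖iteratedDeriv k η t‖ ≤ ⨆ t : ℝ, ‖iteratedDeriv k η t‖ :=
    le_ciSup (f := fun t : ℝ => ‖iteratedDeriv k η t‖)
      ⟨C, by rintro _ ⟨s, rfl⟩; exact hC k le_rfl s⟩ t
  have h2 : (2 : ℝ) ^ (q - k) * (⨆ t : ℝ, ‖iteratedDeriv k η t‖) ≤ CrNorm q η :=
    le_ciSup (f := fun k : Fin (q + 1) =>
      (2 : ℝ) ^ (q - (k : ℕ)) * ⨆ t : ℝ, ‖iteratedDeriv (k : ℕ) η t‖)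
      (Set.finite_range _).bddAbove ⟨k, Nat.lt_succ_of_le hk⟩
  have h3 : (1 : ℝ) ≤ 2 ^ (q - k) := one_le_pow₀ (by norm_num)
  have h4 := le_mul_of_one_le_left ((norm_nonneg _).trans h1) h3
  linarith

end TestFunctions

section AnisotropicNorm

variable {K : ℕ} {N : ℤ} {V W : ℝ × ℝ × ℝ} {δ : ℝ} {p q : ℕ} {h : Heis → ℂ} {η θ : ℝ → ℂ}

lemma continuous_comp_hflow {g : Heis → ℂ} (hg : Continuous g) (W : ℝ × ℝ × ℝ) (m : Heis) :
    Continuous fun t => g (hflow W t m) :=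
  hg.comp (contDiff_hflow_time W m).continuous

lemma ell_eq_integral (hη : TestFun δ η) (W : ℝ × ℝ × ℝ) (m : Heis) (g : Heis → ℂ) :
    ell W δ η m g = ∫ t, η t * g (hflow W t m) := by
  refine intervalIntegral.integral_eq_integral_of_support_subset fun t ht => ?_
  by_contra hne
  refine ht ?_
  have : η t = 0 := hη.eq_zero fun h => hne ⟨h.1, h.2.le⟩
  simp [this]

lemma norm_ell_le (hδ : 0 < δ) {g : Heis → ℂ} {A C : ℝ} (hη : ∀ t, ‖η t‖ ≤ A)
    (hg : ∀ m, ‖g m‖ ≤ C) (m : Heis) : ‖ell W δ η m g‖ ≤ A * C * (2 * δ) := by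
  have := intervalIntegral.norm_integral_le_of_norm_le_const (a := -δ) (b := δ)
    (f := fun t => η t * g (hflow W t m)) (C := A * C) fun t _ => by
      rw [norm_mul]
      exact mul_le_mul (hη t) (hg _) (norm_nonneg _) ((norm_nonneg _).trans (hη t))
  rwa [show δ - -δ = 2 * δ by ring, abs_of_pos (by positivity)] at this

lemma ell_const_mul (W : ℝ × ℝ × ℝ) (δ : ℝ) (c : ℂ) (η : ℝ → ℂ) (m : Heis) (g : Heis → ℂ) :
    ell W δ (fun t => c * η t) m g = c * ell W δ η m g := by
  simp only [ell, mul_assoc]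
  exact intervalIntegral.integral_const_mul _ _

lemma ell_sub (hη : Continuous η) (hθ : Continuous θ) {g : Heis → ℂ} (hg : Continuous g)
    (m : Heis) : ell W δ (fun t => η t - θ t) m g = ell W δ η m g - ell W δ θ m g := by
  have hc := continuous_comp_hflow hg W m
  simp only [ell, sub_mul]
  exact intervalIntegral.integral_sub ((hη.mul hc).intervalIntegrable _ _)
    ((hθ.mul hc).intervalIntegrable _ _)

lemma ell_add_right (hη : Continuous η) {g g' : Heis → ℂ} (hg : Continuous g)
    (hg' : Continuous g') (m : Heis) :
    ell W δ η m (g + g') = ell W δ η m g + ell W δ η m g' := by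
  simp only [ell, Pi.add_apply, mul_add]
  exact intervalIntegral.integral_add
    ((hη.mul (continuous_comp_hflow hg W m)).intervalIntegrable _ _)
    ((hη.mul (continuous_comp_hflow hg' W m)).intervalIntegrable _ _)

lemma ell_smul_right (c : ℂ) (g : Heis → ℂ) (m : Heis) :
    ell W δ η m (c • g) = c * ell W δ η m g := by
  simp only [ell, Pi.smul_apply, smul_eq_mul, mul_left_comm _ c]
  exact intervalIntegral.integral_const_mul _ _

lemma pqNorm_nonneg (V W : ℝ × ℝ × ℝ) (δ : ℝ) (p q : ℕ) (h : Heis → ℂ) :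
    0 ≤ pqNorm V W δ p q h := by
  refine Real.sSup_nonneg ?_
  rintro _ ⟨j, -, m, η, -, -, rfl⟩
  exact norm_nonneg _

lemma pqNorm_le {M : ℝ} (hM : 0 ≤ M) (hb : ∀ j ≤ p, ∀ m η, TestFun δ η → CrNorm q η ≤ 1 →
    ‖ell W δ η m ((VF V)^[j] h)‖ ≤ M) : pqNorm V W δ p q h ≤ M := by
  refine Real.sSup_le ?_ hM
  rintro _ ⟨j, hj, m, η, h1, h2, rfl⟩
  exact hb j hj m η h1 h2

lemma CN.norm_ell_le_pqNorm (hh : CN K N h) (hK : 0 < K) (hδ : 0 < δ) {j : ℕ} (hj : j ≤ p)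
    (hη : TestFun δ η) (hq : CrNorm q η ≤ 1) (m : Heis) :
    ‖ell W δ η m ((_root_.VF V)^[j] h)‖ ≤ pqNorm V W δ p q h := by
  choose C hC using fun j => (hh.iterate_VF V j).exists_norm_le hK
  have hC0 : ∀ j, 0 ≤ C j := fun j => (norm_nonneg _).trans (hC j 0)
  refine le_csSup ⟨(∑ j ∈ Finset.range (p + 1), C j) * (2 * δ), ?_⟩ ⟨j, hj, m, η, hη, hq, rfl⟩
  rintro _ ⟨i, hi, m, θ, h1, h2, rfl⟩
  have h3 := norm_ell_le (W := W) hδ (A := 1)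
    (fun t => by simpa using h1.norm_iteratedDeriv_le_one h2 (Nat.zero_le q) t) (hC i) m
  refine h3.trans ?_
  rw [one_mul]
  gcongr
  exact Finset.single_le_sum (fun k _ => hC0 k) (Finset.mem_range.2 (Nat.lt_succ_of_le hi))

lemma CN.norm_ell_le_mul_pqNorm (hh : CN K N h) (hK : 0 < K) (hδ : 0 < δ) {j : ℕ} (hj : j ≤ p)
    (hθ : TestFun δ θ) {c : ℝ} (hc : ∀ k ≤ q, ∀ t, ‖iteratedDeriv k θ t‖ ≤ c) (m : Heis) :
    ‖ell W δ θ m ((_root_.VF V)^[j] h)‖ ≤ 2 ^ q * c * pqNorm V W δ p q h := by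
  have hc0 : 0 ≤ c := (norm_nonneg _).trans (hc 0 (Nat.zero_le _) 0)
  rcases hc0.eq_or_lt with rfl | hc1
  · have h0 : θ = 0 := funext fun t => by simpa using hc 0 (Nat.zero_le _) t
    simp [h0, ell]
  · have hA : (0 : ℝ) < 2 ^ q * c := by positivity
    have h1 := hh.norm_ell_le_pqNorm (V := V) (W := W) (q := q) hK hδ hj
      (hθ.const_smul ((((2 : ℝ) ^ q * c)⁻¹ : ℝ) : ℂ)) (by
        refine (CrNorm_le (c := ((2 : ℝ) ^ q * c)⁻¹ * c) (by positivity) fun k hk t => ?_).trans ?_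
        · rw [iteratedDeriv_const_mul_field, norm_mul, Complex.norm_real,
            Real.norm_of_nonneg (by positivity)]
          gcongr
          exact hc k hk t
        · apply le_of_eq; field_simp) m
    rw [ell_const_mul, norm_mul, Complex.norm_real, Real.norm_of_nonneg (by positivity),
      inv_mul_le_iff₀ hA] at h1
    exact h1

lemma TestFun.exists_norm_ell_le (hθ : TestFun δ θ) (hK : 0 < K) (hδ : 0 < δ)
    (V W : ℝ × ℝ × ℝ) (N : ℤ) (p q : ℕ) :
    ∃ C, 0 ≤ C ∧ ∀ h, CN K N h → ∀ j ≤ p, ∀ m,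
      ‖ell W δ θ m ((VF V)^[j] h)‖ ≤ C * pqNorm V W δ p q h := by
  obtain ⟨c, hc, hb⟩ := hθ.exists_norm_iteratedDeriv_le q
  exact ⟨2 ^ q * c, by positivity, fun h hh j hj m => hh.norm_ell_le_mul_pqNorm hK hδ hj hθ hb m⟩

end AnisotropicNorm
section Renormalisation

variable {δ : ℝ} {η ρ : ℝ → ℂ}

/-- Taylor approximation at `0` with control of all derivatives of the remainder. -/
lemma exists_taylor_approx (hδ : 0 < δ) (q : ℕ) : ∀ (ζ : ℝ → ℂ) (A ε : ℝ),
    ContDiff ℝ (⊤ : ℕ∞) ζ → (∀ i < q, ‖iteratedDeriv i ζ 0‖ ≤ A) →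
    (∀ t ∈ Set.Icc (-δ) δ, ‖iteratedDeriv q ζ t‖ ≤ ε) →
    ∃ c : ℕ → ℂ, (∀ i < q, ‖c i‖ ≤ A) ∧ ∀ k ≤ q, ∀ t ∈ Set.Icc (-δ) δ,
      ‖iteratedDeriv k (fun s : ℝ => ζ s - ∑ i ∈ Finset.range q, c i * (s : ℂ) ^ i) t‖ ≤
        max 1 δ ^ q * ε := by
  induction q with
  | zero =>
    intro ζ A ε _ _ hε
    refine ⟨0, by simp, fun k hk t ht => ?_⟩
    obtain rfl : k = 0 := Nat.le_zero.1 hk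
    simpa using hε t ht
  | succ q ih =>
    intro ζ A ε hζ hA hε
    have hζ' : ContDiff ℝ (⊤ : ℕ∞) (deriv ζ) := (contDiff_infty_iff_deriv.1 hζ).2
    obtain ⟨c, hc, hR⟩ := ih (deriv ζ) A ε hζ'
      (fun i hi => by rw [← iteratedDeriv_succ']; exact hA _ (Nat.succ_lt_succ hi))
      (fun t ht => by rw [← iteratedDeriv_succ']; exact hε t ht)
    have hε0 : 0 ≤ ε := (norm_nonneg _).trans (hε 0 ⟨by linarith, hδ.le⟩)
    set M := max 1 δ with hM
    have hM1 : 1 ≤ M := le_max_left _ _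
    let d : ℕ → ℂ := fun i => Nat.casesOn i (ζ 0) fun i => c i / (i + 1)
    set R : ℝ → ℂ := fun s => ζ s - ∑ i ∈ Finset.range (q + 1), d i * (s : ℂ) ^ i with hRdef
    have hd : ∀ s, HasDerivAt R (deriv ζ s - ∑ i ∈ Finset.range q, c i * (s : ℂ) ^ i) s := by
      intro s
      have h1 : HasDerivAt ζ (deriv ζ s) s :=
        (hζ.differentiable (by simp)).differentiableAt.hasDerivAt
      have h2 : ∀ i ∈ Finset.range q, HasDerivAt (fun s : ℝ => c i / (i + 1) * (s : ℂ) ^ (i + 1))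
          (c i * (s : ℂ) ^ i) s := by
        intro i _
        have h3 := ((hasDerivAt_id s).ofReal_comp.pow (i + 1)).const_mul (c i / (i + 1))
        have hi : (i : ℂ) + 1 ≠ 0 := by exact_mod_cast Nat.succ_ne_zero i
        refine h3.congr_deriv ?_
        simp
        field_simp
      have h4 := h1.sub ((HasDerivAt.fun_sum h2).add_const (ζ 0))
      refine h4.congr_of_eventuallyEq (Eventually.of_forall fun x => ?_)
      simp only [hRdef, Finset.sum_range_succ', Pi.sub_apply]
      simp [d]
    have hdR : deriv R = fun s : ℝ => deriv ζ s - ∑ i ∈ Finset.range q, c i * (s : ℂ) ^ i :=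
      funext fun s => (hd s).deriv
    have hR0 : R 0 = 0 := by
      simp only [hRdef, Finset.sum_range_succ']
      simp [d]
    have hpow : M ^ q * ε ≤ M ^ (q + 1) * ε := by
      gcongr
      exact Nat.le_succ q
    refine ⟨d, ?_, ?_⟩
    · rintro (_ | i) hi
      · simpa [d] using hA 0 (Nat.succ_pos q)
      · have h1 := hc i (Nat.lt_of_succ_lt_succ hi)
        change ‖c i / ((i : ℂ) + 1)‖ ≤ A
        have h2 : ‖(i : ℂ) + 1‖ = (i : ℝ) + 1 := by
          have : ((i : ℂ) + 1) = ((i + 1 : ℕ) : ℂ) := by push_cast; ring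
          rw [this, Complex.norm_natCast]; push_cast; ring
        rw [norm_div, h2]
        exact (div_le_self (norm_nonneg _) (by linarith [(Nat.cast_nonneg i : (0 : ℝ) ≤ i)])).trans
          h1
    · rintro (_ | k) hk t ht
      · have hmv := Convex.norm_image_sub_le_of_norm_deriv_le (f := R) (s := Set.Icc (-δ) δ)
          (x := 0) (y := t) (C := M ^ q * ε) (fun s _ => (hd s).differentiableAt)
          (fun s hs => by
            rw [hdR]; simpa using hR 0 (Nat.zero_le _) s hs) (convex_Icc _ _)
          ⟨by linarith, hδ.le⟩ ht
        rw [hR0, sub_zero, sub_zero] at hmv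
        have h1 : ‖t‖ ≤ M := (abs_le.2 ht).trans (le_max_right _ _)
        rw [iteratedDeriv_zero]
        calc ‖R t‖ ≤ M ^ q * ε * ‖t‖ := hmv
          _ ≤ M ^ q * ε * M := by gcongr
          _ = M ^ (q + 1) * ε := by ring
      · change ‖iteratedDeriv (k + 1) R t‖ ≤ _
        rw [iteratedDeriv_succ', hdR]
        exact (hR k (Nat.le_of_succ_le_succ hk) t ht).trans hpow

/-- An integral at scale `Λ` is controlled by integrals localised at unit scale. -/
lemma norm_integral_le_of_localised (hδ : 0 < δ) (hη : TestFun δ η) (hρ : TestFun δ ρ)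
    (hρ1 : ∫ s, ρ s = 1) {Λ : ℝ} (hΛ : 1 ≤ Λ) {G : ℝ → ℂ} (hG : Continuous G) {M : ℝ}
    (hM : ∀ u, ‖∫ s, η (Λ⁻¹ * (s + u)) * ρ s * G (u + s)‖ ≤ M) :
    ‖∫ t, η t * G (Λ * t)‖ ≤ 4 * δ * M := by
  have hΛ0 : 0 < Λ := by linarith
  set R : ℝ := Λ * δ + δ with hR
  have hM0 : 0 ≤ M := (norm_nonneg _).trans (hM 0)
  have hηz : ∀ {x : ℝ}, ¬ (-(Λ * δ) < x ∧ x < Λ * δ) → η (Λ⁻¹ * x) = 0 := by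
    intro x hx
    refine hη.eq_zero fun h => hx ⟨?_, ?_⟩
    · have := h.1
      rw [← div_eq_inv_mul, lt_div_iff₀ hΛ0] at this
      linarith
    · have := h.2
      rw [← div_eq_inv_mul, div_lt_iff₀ hΛ0] at this
      linarith
  have hzero : ∀ u s, ¬ (u ∈ Set.Icc (-R) R ∧ s ∈ Set.Icc (-δ) δ) →
      η (Λ⁻¹ * (s + u)) * ρ s * G (u + s) = 0 := by
    intro u s hus
    by_cases hs : s ∈ Set.Ioo (-δ) δ
    · have : η (Λ⁻¹ * (s + u)) = 0 := by
        refine hηz fun h => hus ⟨⟨?_, ?_⟩, hs.1.le, hs.2.le⟩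
        · linarith [h.1, hs.2]
        · linarith [h.2, hs.1]
      simp [this]
    · simp [hρ.eq_zero hs]
  have hcont : Continuous (Function.uncurry fun u s : ℝ =>
      η (Λ⁻¹ * (s + u)) * ρ s * G (u + s)) := by
    have := hη.continuous
    have := hρ.continuous
    simp only [Function.uncurry_def]
    fun_prop
  have hsupp : HasCompactSupport (Function.uncurry fun u s : ℝ =>
      η (Λ⁻¹ * (s + u)) * ρ s * G (u + s)) :=
    HasCompactSupport.intro (isCompact_Icc.prod isCompact_Icc)
      fun x hx => hzero x.1 x.2 fun h => hx ⟨h.1, h.2⟩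
  have hswap := integral_integral_swap_of_hasCompactSupport hcont hsupp
    (μ := (volume : Measure ℝ)) (ν := (volume : Measure ℝ))
  have hinner : ∀ s : ℝ, ∫ u, η (Λ⁻¹ * (s + u)) * ρ s * G (u + s) =
      ρ s * ∫ v, η (Λ⁻¹ * v) * G v := by
    intro s
    rw [← integral_add_right_eq_self (fun v => η (Λ⁻¹ * v) * G v) s, ← integral_const_mul]
    congr 1
    funext u
    rw [add_comm s u]
    ring
  simp only [hinner, integral_mul_const, hρ1, one_mul] at hswap
  have hscale : ∫ t, η t * G (Λ * t) = Λ⁻¹ • ∫ v, η (Λ⁻¹ * v) * G v := by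
    have h1 := Measure.integral_comp_mul_left (fun v => η (Λ⁻¹ * v) * G v) Λ
    rw [abs_of_pos (by positivity)] at h1
    rw [← h1]
    congr 1
    funext t
    rw [inv_mul_cancel_left₀ hΛ0.ne']
  have hset : ∫ u, ∫ s, η (Λ⁻¹ * (s + u)) * ρ s * G (u + s) =
      ∫ u in Set.Icc (-R) R, ∫ s, η (Λ⁻¹ * (s + u)) * ρ s * G (u + s) := by
    refine (setIntegral_eq_integral_of_forall_compl_eq_zero fun u hu => ?_).symm
    simp only [hzero u _ fun h => hu h.1, integral_zero]
  have hbound := norm_setIntegral_le_of_norm_le_const (μ := (volume : Measure ℝ))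
    (s := Set.Icc (-R) R) (C := M) (by simp) fun u _ => hM u
  rw [← hset, hswap, Measure.real, Real.volume_Icc, ENNReal.toReal_ofReal (by nlinarith)] at hbound
  rw [hscale, norm_smul, Real.norm_of_nonneg (by positivity), inv_mul_le_iff₀ hΛ0]
  refine hbound.trans ?_
  have : δ ≤ Λ * δ := le_mul_of_one_le_left hδ.le hΛ
  nlinarith

/-- `Φ` contracts the flow of `V` and expands the flow of `W` by the factor `Λ`, and acts on
`C^∞_N` by composition. -/
structure RenormMap (K : ℕ) (N : ℤ) (V W : ℝ × ℝ × ℝ) (Λ : ℝ) (Φ : Heis → Heis) : Prop where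
  one_le : 1 ≤ Λ
  map_V : ∀ t m, Φ (hflow V t m) = hflow V (Λ⁻¹ * t) (Φ m)
  map_W : ∀ t m, Φ (hflow W t m) = hflow W (Λ * t) (Φ m)
  comp_CN : ∀ h, CN K N h → CN K N (h ∘ Φ)

variable {K : ℕ} {N : ℤ} {V W : ℝ × ℝ × ℝ} {Λ : ℝ} {Φ : Heis → Heis}

lemma RenormMap.iterate_VF (hΦ : RenormMap K N V W Λ Φ) (h : Heis → ℂ) (j : ℕ) :
    (VF V)^[j] (h ∘ Φ) = fun m => (Λ⁻¹ : ℂ) ^ j * (VF V)^[j] h (Φ m) := by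
  induction j with
  | zero => simp [Function.comp_def]
  | succ j ih =>
    rw [Function.iterate_succ_apply', ih, Function.iterate_succ_apply']
    funext m
    simp only [VF, hΦ.map_V]
    rw [deriv_const_mul_field, deriv_comp_mul_left (f := fun t => (VF V)^[j] h (hflow V t (Φ m)))]
    simp [pow_succ, mul_assoc]

lemma RenormMap.ell_comp (hΦ : RenormMap K N V W Λ Φ) (hη : TestFun δ η) (h : Heis → ℂ) (j : ℕ)
    (m : Heis) : ell W δ η m ((VF V)^[j] (h ∘ Φ)) =
      (Λ⁻¹ : ℂ) ^ j * ∫ t, η t * (VF V)^[j] h (hflow W (Λ * t) (Φ m)) := by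
  rw [ell_eq_integral hη, hΦ.iterate_VF, ← integral_const_mul]
  simp only [hΦ.map_W]
  congr 1
  funext t
  ring

lemma iteratedDeriv_comp_affine (hη : ContDiff ℝ (⊤ : ℕ∞) η) (a u : ℝ) (k : ℕ) (t : ℝ) :
    iteratedDeriv k (fun s => η (a * (s + u))) t = a ^ k • iteratedDeriv k η (a * (t + u)) := by
  have h1 := iteratedDeriv_comp_add_const k (fun s => η (a * s)) u
  have h2 := iteratedDeriv_comp_const_smul (contDiff_nat_of_top hη k) a
  rw [h1, h2]

lemma contDiff_comp_affine (hη : ContDiff ℝ (⊤ : ℕ∞) η) (a u : ℝ) :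
    ContDiff ℝ (⊤ : ℕ∞) fun s => η (a * (s + u)) :=
  hη.comp (contDiff_const.mul (contDiff_id.add contDiff_const))

lemma contDiff_ofReal_pow (i : ℕ) : ContDiff ℝ (⊤ : ℕ∞) fun s : ℝ => (s : ℂ) ^ i :=
  Complex.ofRealCLM.contDiff.pow i

/-- A monomial times a test function. -/
def monomialBump (ρ : ℝ → ℂ) (i : ℕ) : ℝ → ℂ := fun s => (s : ℂ) ^ i * ρ s

lemma TestFun.monomialBump (hρ : TestFun δ ρ) (i : ℕ) : TestFun δ (monomialBump ρ i) :=
  hρ.mul_left (contDiff_ofReal_pow i)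

lemma ell_polynomial_mul {g : Heis → ℂ} (hg : Continuous g) (hρ : Continuous ρ) (q : ℕ)
    (c : ℕ → ℂ) (m : Heis) :
    ell W δ (fun s => (∑ i ∈ Finset.range q, c i * (s : ℂ) ^ i) * ρ s) m g =
      ∑ i ∈ Finset.range q, c i * ell W δ (monomialBump ρ i) m g := by
  have hc := continuous_comp_hflow hg W m
  simp only [ell, monomialBump, Finset.sum_mul, ← intervalIntegral.integral_const_mul]
  rw [intervalIntegral.integral_finsetSum]
  · simp only [mul_assoc]
  · intro i _
    exact (((continuous_const.mul (contDiff_ofReal_pow i).continuous).mul hρ).mul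
      hc).intervalIntegrable (μ := volume) _ _

/-- The Lasota–Yorke type inequality. -/
lemma exists_lasotaYorke (hK : 0 < K) (hδ : 0 < δ) (N : ℤ) (V W : ℝ × ℝ × ℝ) (p q : ℕ)
    (hρ : TestFun δ ρ) (hρ1 : ∫ s, ρ s = 1) :
    ∃ C, 0 ≤ C ∧ ∀ Λ Φ, RenormMap K N V W Λ Φ → ∀ h, CN K N h → ∀ ε, 0 ≤ ε →
      (∀ i < q, ∀ j < p, ∀ m, ‖ell W δ (monomialBump ρ i) m ((VF V)^[j] h)‖ ≤ ε) →
      pqNorm V W δ p q (h ∘ Φ) ≤ C * Λ⁻¹ ^ min p q * pqNorm V W δ p q h + C * ε := by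
  obtain ⟨C, hC, hmul⟩ := hρ.exists_norm_iteratedDeriv_mul_le hδ q
  set M := max 1 δ ^ q with hM
  have hM1 : 1 ≤ M := one_le_pow₀ (le_max_left _ _)
  set D := 2 ^ q * (C * M) with hD
  have hD0 : 0 ≤ D := by positivity
  refine ⟨4 * δ * (D + q), by positivity, fun Λ Φ hΦ h hh ε hε hweak => ?_⟩
  set P := pqNorm V W δ p q h with hP
  have hP0 : 0 ≤ P := pqNorm_nonneg _ _ _ _ _ _
  have hΛ0 : 0 < Λ := by linarith [hΦ.one_le]
  have hΛi : 0 ≤ Λ⁻¹ := by positivity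
  have hΛ1 : Λ⁻¹ ≤ 1 := inv_le_one_of_one_le₀ hΦ.one_le
  have hmain : ∀ j ≤ p, ∀ η, TestFun δ η → CrNorm q η ≤ 1 → ∀ u x,
      Λ⁻¹ ^ j * ‖ell W δ (fun s => η (Λ⁻¹ * (s + u)) * ρ s) x ((VF V)^[j] h)‖ ≤
        (D + q) * (Λ⁻¹ ^ min p q * P + ε) := by
    intro j hj η hη hη1 u x
    have hηd : ∀ k ≤ q, ∀ t, ‖iteratedDeriv k (fun s => η (Λ⁻¹ * (s + u))) t‖ ≤ Λ⁻¹ ^ k := by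
      intro k hk t
      rw [iteratedDeriv_comp_affine hη.contDiff, norm_smul, norm_pow, Real.norm_of_nonneg hΛi]
      exact mul_le_of_le_one_right (by positivity) (hη.norm_iteratedDeriv_le_one hη1 hk _)
    have hηs := contDiff_comp_affine hη.contDiff Λ⁻¹ u
    have hg := (hh.iterate_VF V j).contDiff.continuous
    rcases hj.eq_or_lt with rfl | hjp
    · have h1 := hh.norm_ell_le_mul_pqNorm (V := V) (W := W) hK hδ (le_refl j) (hρ.mul_left hηs)
        (hmul _ 1 hηs fun k hk t _ => (hηd k hk t).trans (pow_le_one₀ hΛi hΛ1)) x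
      have h2 : 2 ^ q * (C * 1) ≤ D := by
        rw [hD]; gcongr
      calc _ ≤ Λ⁻¹ ^ j * (2 ^ q * (C * 1) * P) := by gcongr
        _ ≤ Λ⁻¹ ^ min j q * (D * P) := by
          gcongr ?_ * (?_ * _)
          exact pow_le_pow_of_le_one hΛi hΛ1 (min_le_left _ _)
        _ = D * (Λ⁻¹ ^ min j q * P) := by ring
        _ ≤ (D + q) * (Λ⁻¹ ^ min j q * P + ε) := by
          gcongr
          · linarith [(Nat.cast_nonneg q : (0 : ℝ) ≤ q)]
          · linarith
    · obtain ⟨c, hc, hR⟩ := exists_taylor_approx hδ q _ 1 (Λ⁻¹ ^ q) hηs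
        (fun i hi => (hηd i hi.le 0).trans (pow_le_one₀ hΛi hΛ1))
        (fun t _ => hηd q le_rfl t)
      set Q : ℝ → ℂ := fun s => ∑ i ∈ Finset.range q, c i * (s : ℂ) ^ i with hQ
      have hQs : ContDiff ℝ (⊤ : ℕ∞) Q :=
        ContDiff.sum fun i _ => contDiff_const.mul (contDiff_ofReal_pow i)
      have hRs : ContDiff ℝ (⊤ : ℕ∞) fun s => η (Λ⁻¹ * (s + u)) - Q s := hηs.sub hQs
      have h1 := hh.norm_ell_le_mul_pqNorm (V := V) (W := W) hK hδ hj (hρ.mul_left hRs)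
        (hmul _ _ hRs hR) x
      have h2 : ell W δ (fun s => (η (Λ⁻¹ * (s + u)) - Q s) * ρ s) x ((VF V)^[j] h) =
          ell W δ (fun s => η (Λ⁻¹ * (s + u)) * ρ s) x ((VF V)^[j] h) -
          ell W δ (fun s => Q s * ρ s) x ((VF V)^[j] h) := by
        rw [← ell_sub (hρ.mul_left hηs).continuous (hρ.mul_left hQs).continuous hg]
        simp only [sub_mul]
      have h3 : ‖ell W δ (fun s => Q s * ρ s) x ((VF V)^[j] h)‖ ≤ q * ε := by
        rw [ell_polynomial_mul hg hρ.continuous]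
        refine (norm_sum_le _ _).trans ?_
        calc _ ≤ ∑ i ∈ Finset.range q, ε := by
              refine Finset.sum_le_sum fun i hi => ?_
              rw [norm_mul]
              have hi' := Finset.mem_range.1 hi
              exact (mul_le_of_le_one_left (norm_nonneg _) (hc i hi')).trans (hweak i hi' j hjp x)
          _ = q * ε := by simp
      rw [h2] at h1
      have h4 : ‖ell W δ (fun s => η (Λ⁻¹ * (s + u)) * ρ s) x ((VF V)^[j] h)‖ ≤
          2 ^ q * (C * (M * Λ⁻¹ ^ q)) * P + q * ε := by
        have := norm_le_norm_add_norm_sub' (ell W δ (fun s => η (Λ⁻¹ * (s + u)) * ρ s) x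
          ((VF V)^[j] h)) (ell W δ (fun s => Q s * ρ s) x ((VF V)^[j] h))
        linarith
      calc _ ≤ 1 * (2 ^ q * (C * (M * Λ⁻¹ ^ q)) * P + q * ε) := by
            gcongr
            exact pow_le_one₀ hΛi hΛ1
        _ = D * (Λ⁻¹ ^ q * P) + q * ε := by rw [hD]; ring
        _ ≤ D * (Λ⁻¹ ^ min p q * P) + q * ε := by
            gcongr ?_ * (?_ * _) + _
            exact pow_le_pow_of_le_one hΛi hΛ1 (min_le_right _ _)
        _ ≤ (D + q) * (Λ⁻¹ ^ min p q * P + ε) := by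
            have e1 : 0 ≤ (q : ℝ) * (Λ⁻¹ ^ min p q * P) := by positivity
            have e2 : 0 ≤ D * ε := by positivity
            linarith
  refine (pqNorm_le (M := 4 * δ * ((D + q) * (Λ⁻¹ ^ min p q * P + ε))) (by positivity)
    fun j hj m η hη hη1 => ?_).trans_eq (by ring)
  have hg := (hh.iterate_VF V j).contDiff.continuous
  rw [hΦ.ell_comp hη, norm_mul, norm_pow, norm_inv, Complex.norm_real,
    Real.norm_of_nonneg hΛ0.le]
  have hloc := norm_integral_le_of_localised hδ hη hρ hρ1 hΦ.one_le
    (continuous_comp_hflow hg W (Φ m))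
    (M := (Λ⁻¹ ^ j)⁻¹ * ((D + q) * (Λ⁻¹ ^ min p q * P + ε))) fun u => by
      have h1 := hmain j hj η hη hη1 u (hflow W u (Φ m))
      rw [ell_eq_integral (hρ.mul_left (contDiff_comp_affine hη.contDiff Λ⁻¹ u))] at h1
      simp only [← hflow_add] at h1
      rwa [← div_eq_inv_mul, le_div_iff₀ (by positivity), mul_comm]
  have hj0 : 0 < Λ⁻¹ ^ j := by positivity
  calc _ ≤ Λ⁻¹ ^ j * (4 * δ * ((Λ⁻¹ ^ j)⁻¹ * ((D + q) * (Λ⁻¹ ^ min p q * P + ε)))) := by gcongr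
    _ = _ := by field_simp

end Renormalisation

section Frame

variable {V W : ℝ × ℝ × ℝ}

/-- The `V`-coordinate of `m` relative to `m₀`. -/
def frameV (W : ℝ × ℝ × ℝ) (m₀ m : Heis) : ℝ := (m.1 - m₀.1) * W.2.1 - (m.2.1 - m₀.2.1) * W.1

/-- The `W`-coordinate of `m` relative to `m₀`. -/
def frameW (V : ℝ × ℝ × ℝ) (m₀ m : Heis) : ℝ := V.1 * (m.2.1 - m₀.2.1) - V.2.1 * (m.1 - m₀.1)

/-- The `Z`-coordinate of `m` relative to `m₀`. -/
def frameZ (V W : ℝ × ℝ × ℝ) (m₀ m : Heis) : ℝ :=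
  m.2.2 - (hflow W (frameW V m₀ m) (hflow V (frameV W m₀ m) m₀)).2.2

lemma hflow_frame (hVW : hbracket V W = Zvec) (m₀ m : Heis) :
    hflow Zvec (frameZ V W m₀ m) (hflow W (frameW V m₀ m) (hflow V (frameV W m₀ m) m₀)) = m := by
  have h : V.1 * W.2.1 - W.1 * V.2.1 = 1 := by
    simpa [hbracket, Zvec] using hVW
  refine Prod.ext ?_ (Prod.ext ?_ ?_)
  · simp only [hflow_eq, Zvec, frameV, frameW]
    linear_combination (m.1 - m₀.1) * h
  · simp only [hflow_eq, Zvec, frameV, frameW]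
    linear_combination (m.2.1 - m₀.2.1) * h
  · rw [hflow_eq Zvec]
    simp [Zvec, frameZ]

lemma contDiff_frameV (W : ℝ × ℝ × ℝ) (m₀ : Heis) : ContDiff ℝ (⊤ : ℕ∞) (frameV W m₀) := by
  unfold frameV
  fun_prop

lemma contDiff_frameW (V : ℝ × ℝ × ℝ) (m₀ : Heis) : ContDiff ℝ (⊤ : ℕ∞) (frameW V m₀) := by
  unfold frameW
  fun_prop

lemma contDiff_frameZ (V W : ℝ × ℝ × ℝ) (m₀ : Heis) : ContDiff ℝ (⊤ : ℕ∞) (frameZ V W m₀) := by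
  have h1 := contDiff_frameV W m₀
  have h2 := contDiff_frameW V m₀
  unfold frameZ
  simp only [hflow_eq]
  fun_prop

lemma frameV_self (W : ℝ × ℝ × ℝ) (m : Heis) : frameV W m m = 0 := by simp [frameV]

lemma frameW_self (V : ℝ × ℝ × ℝ) (m : Heis) : frameW V m m = 0 := by simp [frameW]

end Frame

section Equicontinuity

variable {K : ℕ} {N : ℤ} {V W : ℝ × ℝ × ℝ} {δ : ℝ} {p q : ℕ} {h g : Heis → ℂ} {η θ : ℝ → ℂ}

lemma TestFun.deriv (hη : TestFun δ η) : TestFun δ (deriv η) :=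
  ⟨(contDiff_infty_iff_deriv.1 hη.contDiff).2, hη.2.1.deriv,
    (closure_minimal (support_deriv_subset (𝕜 := ℝ)) (isClosed_tsupport _)).trans hη.2.2⟩

lemma hasDerivAt_ell (hδ : 0 < δ) (hη : Continuous η) (hg : Continuous g) {γ : ℝ → Heis}
    {D : ℝ → ℝ → ℂ} (hD : ∀ a t, HasDerivAt (fun a => g (hflow W t (γ a))) (D a t) a)
    (hDc : ∀ a, Continuous (D a)) {C : ℝ} (hC : ∀ a, ∀ t ∈ Set.Icc (-δ) δ, ‖D a t‖ ≤ C) (s : ℝ) :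
    HasDerivAt (fun a => ell W δ η (γ a) g) (∫ t in (-δ)..δ, η t * D s t) s := by
  obtain ⟨A, hA⟩ := (isCompact_Icc (a := -δ) (b := δ)).exists_bound_of_continuousOn
    hη.continuousOn
  refine (intervalIntegral.hasDerivAt_integral_of_dominated_loc_of_deriv_le
    (F := fun a t => η t * g (hflow W t (γ a))) (F' := fun a t => η t * D a t)
    (bound := fun _ => A * C) (s := Set.univ) univ_mem ?_ ?_ ?_ ?_ ?_ ?_).2
  · exact Eventually.of_forall fun a =>
      (hη.mul (continuous_comp_hflow hg W (γ a))).aestronglyMeasurable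
  · exact (hη.mul (continuous_comp_hflow hg W (γ s))).intervalIntegrable _ _
  · exact (hη.mul (hDc s)).aestronglyMeasurable
  · refine Eventually.of_forall fun t ht a _ => ?_
    rw [Set.uIoc_of_le (by linarith)] at ht
    have ht' := Set.Ioc_subset_Icc_self ht
    rw [norm_mul]
    exact mul_le_mul (hA t ht') (hC a t ht') (norm_nonneg _) ((norm_nonneg _).trans (hA t ht'))
  · exact intervalIntegrable_const
  · exact Eventually.of_forall fun t _ a _ => (hD a t).const_mul (η t)

lemma CN.hasDerivAt_ell_hflow_V (hh : CN K N h) (hK : 0 < K) (hδ : 0 < δ)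
    (hVW : hbracket V W = Zvec) (hη : TestFun δ η) (m : Heis) (s : ℝ) :
    HasDerivAt (fun a => ell W δ η (hflow V a m) h)
      (ell W δ η (hflow V s m) (_root_.VF V h) +
        centralChar K N * ell W δ (monomialBump η 1) (hflow V s m) h) s := by
  obtain ⟨A, hA⟩ := hh.exists_norm_le hK
  obtain ⟨B, hB⟩ := (hh.VF V).exists_norm_le hK
  have hc := hh.contDiff.continuous
  have hc' := (hh.VF V).contDiff.continuous
  have h1 := hasDerivAt_ell (C := B + ‖centralChar K N‖ * δ * A) hδ hη.continuous hc
    (fun a t => hh.hasDerivAt_hflow_hflow hVW a t m) (fun a => ?_) (fun a t ht => ?_) s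
  · convert h1 using 1
    simp only [ell, monomialBump, ← intervalIntegral.integral_const_mul]
    rw [← intervalIntegral.integral_add]
    · congr 1
      funext t
      ring
    · exact (hη.continuous.mul (continuous_comp_hflow hc' W _)).intervalIntegrable _ _
    · exact (continuous_const.mul (((contDiff_ofReal_pow 1).continuous.mul hη.continuous).mul
        (continuous_comp_hflow hc W _))).intervalIntegrable (μ := volume) _ _
  · exact (continuous_comp_hflow hc' W _).add ((continuous_const.mul
      Complex.continuous_ofReal).mul (continuous_comp_hflow hc W _))
  · refine (norm_add_le _ _).trans (add_le_add (hB _) ?_)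
    rw [norm_mul, norm_mul, Complex.norm_real]
    gcongr
    · exact abs_le.2 ht
    · exact hA _

lemma CN.hasDerivAt_ell_hflow_W (hh : CN K N h) (hK : 0 < K) (hδ : 0 < δ)
    (hη : TestFun δ η) (m : Heis) (s : ℝ) :
    HasDerivAt (fun a => ell W δ η (hflow W a m) h)
      (-ell W δ (_root_.deriv η) (hflow W s m) h) s := by
  obtain ⟨B, hB⟩ := (hh.VF W).exists_norm_le hK
  have hc' := (hh.VF W).contDiff.continuous
  have h1 := hasDerivAt_ell (W := W) (γ := fun a => hflow W a m)
    (D := fun a t => _root_.VF W h (hflow W t (hflow W a m))) (C := B) hδ hη.continuous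
    hh.contDiff.continuous (fun a t => ?_) (fun a => continuous_comp_hflow hc' W _)
    (fun a t _ => hB _) s
  · convert h1 using 1
    rw [intervalIntegral.integral_mul_deriv_eq_deriv_mul
      (fun t _ => ((hη.contDiff.differentiable (by simp)).differentiableAt.hasDerivAt))
      (fun t _ => hasDerivAt_comp_hflow hh.contDiff W (hflow W s m) t)
      (hη.deriv.continuous.intervalIntegrable _ _)
      ((continuous_comp_hflow hc' W _).intervalIntegrable _ _),
      hη.eq_zero (by simp), hη.eq_zero (by simp)]
    simp [ell]
  · have h2 := hasDerivAt_comp_hflow hh.contDiff W (hflow W t m) a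
    simpa only [← hflow_add, add_comm] using h2

lemma CN.ell_hflow_Zvec (hh : CN K N h) (c : ℝ) (m : Heis) :
    ell W δ η (hflow Zvec c m) h = Complex.exp (centralChar K N * c) * ell W δ η m h := by
  simp only [ell, hflow_Zvec_comm, hh.hflow_Zvec, ← intervalIntegral.integral_const_mul]
  congr 1
  funext t
  ring

lemma CN.ell_hmul (hh : CN K N h) {γ : Heis} (hγ : γ ∈ GammaK K) (m : Heis) :
    ell W δ η (hmul γ m) h = ell W δ η m h := by
  simp only [ell, hflow_hmul, hh.hmul_eq hγ]

/-- The functionals `m ↦ ℓ_{θ,m}(V^j h)` with `j < p` are equicontinuous. -/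
lemma TestFun.exists_equicontinuous (hθ : TestFun δ θ) (hK : 0 < K) (hδ : 0 < δ)
    (hVW : hbracket V W = Zvec) (N : ℤ) (p q : ℕ) :
    ∃ C, 0 ≤ C ∧ ∀ h, CN K N h → ∀ j < p, ∀ a b c m,
      ‖ell W δ θ (hflow Zvec c (hflow W b (hflow V a m))) ((VF V)^[j] h)‖ ≤
        ‖ell W δ θ m ((VF V)^[j] h)‖ + C * (|a| + |b|) * pqNorm V W δ p q h := by
  obtain ⟨C₀, hC₀, h0⟩ := hθ.exists_norm_ell_le hK hδ V W N p q
  obtain ⟨C₁, hC₁, h1⟩ := (hθ.monomialBump 1).exists_norm_ell_le hK hδ V W N p q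
  obtain ⟨C₂, hC₂, h2⟩ := hθ.deriv.exists_norm_ell_le hK hδ V W N p q
  refine ⟨C₀ + ‖centralChar K N‖ * C₁ + C₂, by positivity, fun h hh j hj a b c m => ?_⟩
  set P := pqNorm V W δ p q h
  have hP : 0 ≤ P := pqNorm_nonneg _ _ _ _ _ _
  have hg := hh.iterate_VF V j
  have hV := Convex.norm_image_sub_le_of_norm_hasDerivWithin_le (s := Set.univ)
    (C := (C₀ + ‖centralChar K N‖ * C₁) * P) (x := 0) (y := a)
    (fun s _ => (hg.hasDerivAt_ell_hflow_V hK hδ hVW hθ m s).hasDerivWithinAt)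
    (fun s _ => by
      refine (norm_add_le _ _).trans ?_
      rw [← Function.iterate_succ_apply' (VF V), norm_mul, add_mul, mul_assoc]
      exact add_le_add (h0 h hh _ hj _)
        (mul_le_mul_of_nonneg_left (h1 h hh _ hj.le _) (norm_nonneg _)))
    convex_univ (Set.mem_univ _) (Set.mem_univ _)
  have hW := Convex.norm_image_sub_le_of_norm_hasDerivWithin_le (s := Set.univ)
    (C := C₂ * P) (x := 0) (y := b)
    (fun s _ => (hg.hasDerivAt_ell_hflow_W (W := W) hK hδ hθ (hflow V a m) s).hasDerivWithinAt)
    (fun s _ => by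
      rw [norm_neg]
      exact h2 h hh _ hj.le _)
    convex_univ (Set.mem_univ _) (Set.mem_univ _)
  simp only [hflow_zero, sub_zero, Real.norm_eq_abs] at hV hW
  rw [hg.ell_hflow_Zvec, norm_mul, norm_exp_centralChar_mul, one_mul]
  have e1 := norm_le_norm_add_norm_sub' (ell W δ θ (hflow W b (hflow V a m)) ((VF V)^[j] h))
    (ell W δ θ (hflow V a m) ((VF V)^[j] h))
  have e2 := norm_le_norm_add_norm_sub' (ell W δ θ (hflow V a m) ((VF V)^[j] h))
    (ell W δ θ m ((VF V)^[j] h))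
  have e3 : 0 ≤ (C₀ + ‖centralChar K N‖ * C₁) * P * |b| := by positivity
  have e4 : 0 ≤ C₂ * P * |a| := by positivity
  linarith

/-- Up to a small multiple of the norm, finitely many base points suffice to control the
functionals `ℓ_{θ,m}(V^j h)` with `j < p`. -/
lemma TestFun.exists_finset_norm_ell_le (hθ : TestFun δ θ) (hK : 0 < K) (hδ : 0 < δ)
    (hVW : hbracket V W = Zvec) (N : ℤ) (p q : ℕ) {ε : ℝ} (hε : 0 < ε) :
    ∃ A : Finset Heis, ∀ h, CN K N h → ∀ j < p, ∀ m, ∃ a ∈ A,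
      ‖ell W δ θ m ((VF V)^[j] h)‖ ≤
        ‖ell W δ θ a ((VF V)^[j] h)‖ + ε * pqNorm V W δ p q h := by
  obtain ⟨C, hC, hb⟩ := hθ.exists_equicontinuous hK hδ hVW N p q
  have hnhds : ∀ a : Heis, ∀ᶠ m in nhds a, C * (|frameV W a m| + |frameW V a m|) < ε := by
    intro a
    have hcont : Continuous fun m => C * (|frameV W a m| + |frameW V a m|) :=
      continuous_const.mul ((contDiff_frameV W a).continuous.abs.add
        (contDiff_frameW V a).continuous.abs)
    refine hcont.continuousAt.eventually_lt continuousAt_const ?_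
    simpa [frameV_self, frameW_self] using hε
  obtain ⟨A, -, hA⟩ := isCompact_box.elim_nhds_subcover _ fun a _ => hnhds a
  refine ⟨A, fun h hh j hj m => ?_⟩
  obtain ⟨γ, hγ, hm⟩ := exists_mem_GammaK_hmul_mem hK m
  obtain ⟨a, ha, hma⟩ := Set.mem_iUnion₂.1 (hA hm)
  refine ⟨a, ha, ?_⟩
  have h1 := hb h hh j hj (frameV W a (hmul γ m)) (frameW V a (hmul γ m))
    (frameZ V W a (hmul γ m)) a
  rw [hflow_frame hVW, (hh.iterate_VF V j).ell_hmul hγ] at h1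
  refine h1.trans (add_le_add le_rfl ?_)
  exact mul_le_mul_of_nonneg_right (le_of_lt hma) (pqNorm_nonneg _ _ _ _ _ _)

lemma exists_testFun_integral_eq_one (hδ : 0 < δ) : ∃ ρ, TestFun δ ρ ∧ ∫ s, ρ s = 1 := by
  let f : ContDiffBump (0 : ℝ) := ⟨δ / 4, δ / 2, by positivity, by linarith⟩
  have hsupp : Function.support (fun s => ((f.normed volume s : ℝ) : ℂ)) =
      Function.support (f.normed volume) := by
    ext s
    simp
  have hts : tsupport (fun s => ((f.normed volume s : ℝ) : ℂ)) = Metric.closedBall 0 (δ / 2) := by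
    rw [tsupport, hsupp]
    exact f.tsupport_normed_eq
  refine ⟨fun s => (f.normed volume s : ℝ), ⟨?_, ?_, ?_⟩, ?_⟩
  · exact Complex.ofRealCLM.contDiff.comp f.contDiff_normed
  · rw [HasCompactSupport, hts]
    exact isCompact_closedBall _ _
  · rw [hts, Real.closedBall_eq_Icc]
    exact Set.Icc_subset_Ioo (by linarith) (by linarith)
  · rw [integral_complex_ofReal, f.integral_normed]
    simp

/-- The norm of `h ∘ Φ` is bounded by `Λ ^ (-min p q)` times the norm of `h`, up to finitely many
functionals. -/
lemma exists_pqNorm_comp_le (hK : 0 < K) (hδ : 0 < δ) (hVW : hbracket V W = Zvec) (N : ℤ)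
    (p q : ℕ) : ∃ C, 0 ≤ C ∧ ∀ Λ Φ, RenormMap K N V W Λ Φ →
      ∃ (k : ℕ) (θ : Fin k → ℝ → ℂ) (j : Fin k → ℕ) (a : Fin k → Heis),
        (∀ i, TestFun δ (θ i)) ∧ (∀ i, j i ≤ p) ∧ ∀ h, CN K N h → ∀ c, 0 ≤ c →
          (∀ i, ‖ell W δ (θ i) (a i) ((VF V)^[j i] h)‖ ≤ c) →
          pqNorm V W δ p q (h ∘ Φ) ≤ C * Λ⁻¹ ^ min p q * pqNorm V W δ p q h + C * c := by
  obtain ⟨ρ, hρ, hρ1⟩ := exists_testFun_integral_eq_one hδ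
  obtain ⟨C, hC, hLY⟩ := exists_lasotaYorke hK hδ N V W p q hρ hρ1
  refine ⟨2 * C, by positivity, fun Λ Φ hΦ => ?_⟩
  have hΛ0 : 0 < Λ := by linarith [hΦ.one_le]
  have hε : 0 < Λ⁻¹ ^ min p q := by positivity
  choose A hA using fun i : ℕ =>
    (hρ.monomialBump i).exists_finset_norm_ell_le hK hδ hVW N p q hε
  let ι := Σ i : Fin q, Fin p × A i
  let e := Fintype.equivFin ι
  refine ⟨Fintype.card ι, fun x => monomialBump ρ (e.symm x).1, fun x => (e.symm x).2.1,
    fun x => (e.symm x).2.2, fun x => hρ.monomialBump _, fun x => (e.symm x).2.1.2.le,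
    fun h hh c hc hb => ?_⟩
  have hP : 0 ≤ pqNorm V W δ p q h := pqNorm_nonneg _ _ _ _ _ _
  refine (hLY Λ Φ hΦ h hh (c + Λ⁻¹ ^ min p q * pqNorm V W δ p q h) (by positivity)
    fun i hi j hj m => ?_).trans ?_
  · obtain ⟨a, ha, hm⟩ := hA i h hh j hj m
    refine hm.trans (add_le_add ?_ le_rfl)
    have hb' := (e.symm.surjective.forall (p := fun x : ι =>
      ‖ell W δ (monomialBump ρ x.1) x.2.2 ((VF V)^[x.2.1] h)‖ ≤ c)).2 hb
    exact hb' ⟨⟨i, hi⟩, ⟨j, hj⟩, ⟨a, ha⟩⟩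
  · have : 0 ≤ C * c := by positivity
    linarith

end Equicontinuity

section Automorphism

variable {K : ℕ} {N : ℤ} {V W : ℝ × ℝ × ℝ} {Λ Λ' : ℝ} {Φ Φ' : Heis → Heis}

lemma RenormMap.refl : RenormMap K N V W 1 id :=
  ⟨le_rfl, fun t m => by simp, fun t m => by simp, fun _ hh => hh⟩

lemma RenormMap.comp (h : RenormMap K N V W Λ Φ) (h' : RenormMap K N V W Λ' Φ') :
    RenormMap K N V W (Λ * Λ') (Φ ∘ Φ') :=
  ⟨one_le_mul_of_one_le_of_one_le h.one_le h'.one_le,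
    fun t m => by rw [Function.comp_apply, h'.map_V, h.map_V, mul_inv, mul_assoc]; rfl,
    fun t m => by rw [Function.comp_apply, h'.map_W, h.map_W, mul_assoc]; rfl,
    fun g hg => h'.comp_CN _ (h.comp_CN g hg)⟩

lemma RenormMap.iterate (h : RenormMap K N V W Λ Φ) (n : ℕ) :
    RenormMap K N V W (Λ ^ n) Φ^[n] := by
  induction n with
  | zero => simpa using RenormMap.refl
  | succ n ih => rw [pow_succ, Function.iterate_succ]; exact ih.comp h

namespace NilSetting

variable (S : NilSetting)

lemma map_hflow_V (t : ℝ) (m : Heis) : S.Φ (hflow S.Vd t m) = hflow S.Vd (S.lam⁻¹ * t) (S.Φ m) := by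
  rw [hflow, S.Φhom, S.ΦV, hflow]

lemma map_hflow_W (t : ℝ) (m : Heis) : S.Φ (hflow S.Wd t m) = hflow S.Wd (S.lam * t) (S.Φ m) := by
  rw [hflow, S.Φhom, S.ΦW, hflow]

lemma map_hflow_Zvec (t : ℝ) (m : Heis) : S.Φ (hflow Zvec t m) = hflow Zvec t (S.Φ m) := by
  rw [hflow, S.Φhom, S.ΦZ, hflow]

lemma contDiff_Φ : ContDiff ℝ (⊤ : ℕ∞) S.Φ := by
  have h : S.Φ = fun m => hflow Zvec (frameZ S.Vd S.Wd 0 m)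
      (hflow S.Wd (S.lam * frameW S.Vd 0 m) (hflow S.Vd (S.lam⁻¹ * frameV S.Wd 0 m) (S.Φ 0))) := by
    funext m
    conv_lhs => rw [← hflow_frame S.frame 0 m]
    rw [S.map_hflow_Zvec, S.map_hflow_W, S.map_hflow_V]
  rw [h]
  refine (contDiff_hflow _).comp ((contDiff_frameZ _ _ _).prodMk ?_)
  refine (contDiff_hflow _).comp ((contDiff_const.mul (contDiff_frameW _ _)).prodMk ?_)
  exact (contDiff_hflow _).comp ((contDiff_const.mul (contDiff_frameV _ _)).prodMk contDiff_const)

lemma renormMap (N : ℤ) : RenormMap S.K N S.Vd S.Wd S.lam S.Φ := by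
  refine ⟨S.hlam.le, S.map_hflow_V, S.map_hflow_W, fun h hh => ?_⟩
  refine CN.of_hflow_Zvec ⟨hh.contDiff.comp S.contDiff_Φ, fun γ hγ m => ?_⟩ fun c m => ?_
  · rw [Function.comp_apply, S.Φhom]
    exact hh.hmul_eq (S.Φlattice ▸ Set.mem_image_of_mem _ hγ) _
  · rw [Function.comp_apply, S.map_hflow_Zvec]
    exact hh.hflow_Zvec c _

/-- `C^∞_N` as a space of functions. -/
def cnSubmodule (N : ℤ) : Submodule ℂ (Heis → ℂ) where
  carrier := S.cn N
  add_mem' := CN.add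
  zero_mem' := CN.zero
  smul_mem' c _ hh := CN.smul hh c

/-- The transfer operator on `C^∞_N`. -/
def transfer (N : ℤ) : S.cnSubmodule N →ₗ[ℂ] S.cnSubmodule N where
  toFun h := ⟨S.L h, (S.renormMap N).comp_CN _ h.2⟩
  map_add' _ _ := rfl
  map_smul' _ _ := rfl

/-- The functional `h ↦ ℓ_{θ,m}(V^j h)` on `C^∞_N`. -/
def functional (N : ℤ) {θ : ℝ → ℂ} (hθ : TestFun S.δ θ) (i : ℕ) (m : Heis) :
    S.cnSubmodule N →ₗ[ℂ] ℂ where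
  toFun h := ell S.Wd S.δ θ m ((VF S.Vd)^[i] h)
  map_add' h h' := by
    have hh : CN S.K N h := h.2
    have hh' : CN S.K N h' := h'.2
    rw [Submodule.coe_add, hh.iterate_VF_add hh']
    exact ell_add_right hθ.continuous (hh.iterate_VF _ i).contDiff.continuous
      (hh'.iterate_VF _ i).contDiff.continuous m
  map_smul' c h := by
    have hh : CN S.K N h := h.2
    rw [Submodule.coe_smul, hh.iterate_VF_smul]
    exact ell_smul_right c _ m

variable {S} {N : ℤ} {p q : ℕ} {B : Type} [NormedAddCommGroup B] [NormedSpace ℂ B]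
  {j : (Heis → ℂ) → B}

/-- The inclusion of `C^∞_N` into its completion. -/
def embed (hB : IsCompletion (S.nrm p q) (S.cn N) j) : S.cnSubmodule N →ₗ[ℂ] B where
  toFun h := j h
  map_add' h h' := hB.2.1 _ h.2 _ h'.2
  map_smul' c h := hB.2.2.1 c _ h.2

variable (hB : IsCompletion (S.nrm p q) (S.cn N) j)

lemma norm_embed (h : S.cnSubmodule N) : ‖embed hB h‖ = pqNorm S.Vd S.Wd S.δ p q h :=
  hB.2.2.2.1 _ h.2

lemma denseRange_embed : DenseRange (embed hB) := by
  have h1 : Set.range (embed hB) = j '' S.cn N := by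
    rw [Set.image_eq_range]
    rfl
  rw [DenseRange, h1]
  exact hB.2.2.2.2

lemma iterate_transfer (n : ℕ) (h : S.cnSubmodule N) :
    (((S.transfer N)^[n] h : S.cnSubmodule N) : Heis → ℂ) = h ∘ S.Φ^[n] := by
  induction n with
  | zero => rfl
  | succ n ih =>
    rw [Function.iterate_succ_apply', Function.iterate_succ, ← Function.comp_assoc, ← ih]
    rfl

lemma exists_norm_functional_le {θ : ℝ → ℂ} (hθ : TestFun S.δ θ) {i : ℕ} (hi : i ≤ p)
    (m : Heis) : ∃ C, 0 ≤ C ∧ ∀ h, ‖S.functional N hθ i m h‖ ≤ C * ‖embed hB h‖ := by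
  obtain ⟨C, hC, hb⟩ := hθ.exists_norm_ell_le S.hK S.hδ S.Vd S.Wd N p q
  refine ⟨C, hC, fun h => ?_⟩
  rw [norm_embed]
  exact hb _ h.2 i hi m

/-- Uniform bound for the iterates of the transfer operator modulo finite rank. -/
lemma exists_norm_iterate_transfer_le : ∃ C, 0 ≤ C ∧ ∀ n : ℕ,
    ∃ (k : ℕ) (F : B →L[ℂ] (Fin k → ℂ)), ∀ h : S.cnSubmodule N,
      ‖embed hB ((S.transfer N)^[n] h)‖ ≤
        C * (S.lam⁻¹ ^ min p q) ^ n * ‖embed hB h‖ + ‖F (embed hB h)‖ := by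
  obtain ⟨C, hC, hb⟩ := exists_pqNorm_comp_le S.hK S.hδ S.frame N p q
  refine ⟨C, hC, fun n => ?_⟩
  obtain ⟨k, θ, i, a, hθ, hi, hle⟩ := hb _ _ ((S.renormMap N).iterate n)
  let f : S.cnSubmodule N →ₗ[ℂ] (Fin k → ℂ) :=
    LinearMap.pi fun x => S.functional N (hθ x) (i x) (a x)
  choose D hD0 hD using fun x => exists_norm_functional_le hB (hθ x) (hi x) (a x)
  have hf : ∃ C, ∀ h, ‖f h‖ ≤ C * ‖embed hB h‖ := by
    refine ⟨∑ x, D x, fun h => ?_⟩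
    refine (pi_norm_le_iff_of_nonneg (mul_nonneg (Finset.sum_nonneg fun x _ => hD0 x)
      (norm_nonneg _))).2 fun x => (hD x h).trans ?_
    gcongr
    exact Finset.single_le_sum (fun x _ => hD0 x) (Finset.mem_univ x)
  refine ⟨k, (C : ℂ) • f.extendOfNorm (embed hB), fun h => ?_⟩
  rw [norm_embed, iterate_transfer, smul_apply, norm_smul, Complex.norm_real,
    Real.norm_of_nonneg hC, LinearMap.extendOfNorm_eq (denseRange_embed hB) hf, norm_embed]
  have h1 := hle h h.2 ‖f h‖ (norm_nonneg _) fun x => norm_le_pi_norm (f h) x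
  rwa [← inv_pow, ← pow_mul, mul_comm n, pow_mul] at h1

lemma exists_transferExtension : ∃ T : B →L[ℂ] B,
    (∀ h, T (embed hB h) = embed hB (S.transfer N h)) ∧
      QuasiCompactRate T (S.lam⁻¹ ^ min p q) := by
  have := hB.1
  obtain ⟨C, hC, hb⟩ := exists_norm_iterate_transfer_le hB
  have hnorm : ∃ D, ∀ h, ‖(embed hB ∘ₗ S.transfer N) h‖ ≤ D * ‖embed hB h‖ := by
    obtain ⟨k, F, hF⟩ := hb 1
    refine ⟨C * (S.lam⁻¹ ^ min p q) ^ 1 + ‖F‖, fun h => (hF h).trans ?_⟩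
    rw [add_mul]
    gcongr
    exact F.le_opNorm _
  set T : B →L[ℂ] B := (embed hB ∘ₗ S.transfer N).extendOfNorm (embed hB) with hT
  have hTe : ∀ h, T (embed hB h) = embed hB (S.transfer N h) := fun h =>
    LinearMap.extendOfNorm_eq (denseRange_embed hB) hnorm h
  have hTn : ∀ n h, (T ^ n) (embed hB h) = embed hB ((S.transfer N)^[n] h) := by
    intro n h
    induction n with
    | zero => rfl
    | succ n ih =>
      rw [pow_succ', mul_apply_eq_comp, ih, hTe, Function.iterate_succ_apply']
  refine ⟨T, hTe, C, hC, fun n => ?_⟩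
  obtain ⟨k, F, hF⟩ := hb (n + 1)
  refine ⟨k, F, fun x => ?_⟩
  refine (denseRange_embed hB).induction_on x ?_ fun h => ?_
  · exact isClosed_le (by fun_prop) (by fun_prop)
  · rw [hTn]
    exact hF h

end NilSetting

end Automorphism

/-- **Lemma 3.9 (essential spectral radius).** Let `p, q ∈ ℕ` and `N ≠ 0`. The
essential spectral radius of `L : B^{p,q}_N → B^{p,q}_N` is at most `λ^{-min(p,q)}`:
every spectral point `z` with `|z| > λ^{-min(p,q)}` is an isolated eigenvalue of
finite (algebraic) multiplicity. -/
theorem essential_spectral_radius (S : NilSetting) (N : ℤ) (hN : N ≠ 0)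
    (p q : ℕ) (hp : 1 ≤ p) (hq : 1 ≤ q)
    (B : Type) [NormedAddCommGroup B] [NormedSpace ℂ B] (j : (Heis → ℂ) → B)
    (hB : IsCompletion (S.nrm p q) (S.cn N) j) :
    ∃ Lb : B →L[ℂ] B,
      (∀ h ∈ S.cn N, Lb (j h) = j (S.L h)) ∧
      ∀ z ∈ spectrum ℂ Lb, S.lam ^ (-(min p q : ℤ)) < ‖z‖ →
        -- `z` is isolated in the spectrum
        (∃ ε : ℝ, 0 < ε ∧ ∀ w ∈ spectrum ℂ Lb, w ≠ z → ε ≤ ‖w - z‖) ∧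
        -- `z` is an eigenvalue
        (∃ x : B, x ≠ 0 ∧ Lb x = z • x) ∧
        -- of finite algebraic multiplicity
        FiniteDimensional ℂ
          ↥(⨆ k : ℕ, LinearMap.ker ((Lb.toLinearMap - z • (LinearMap.id : B →ₗ[ℂ] B)) ^ k)) := by
  have := hB.1
  obtain ⟨T, hT, hrate⟩ := NilSetting.exists_transferExtension hB
  have hlam : 0 < S.lam := by linarith [S.hlam]
  refine ⟨T, fun h hh => hT ⟨h, hh⟩, fun z hz hlt => ?_⟩
  have hz' : S.lam⁻¹ ^ min p q < ‖z‖ := by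
    rwa [← Nat.cast_min, zpow_neg, zpow_natCast, ← inv_pow] at hlt
  have hμ : 0 < S.lam⁻¹ ^ min p q := by positivity
  exact ⟨hrate.isolated hμ hz', hrate.exists_eigenvector hμ hz' hz,
    hrate.finiteDimensional_generalized hμ hz'⟩
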